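/- (Lower Bound Theorem for almost simplicial polytopes.) Let d ≥ 3, s ≥ 0, n ≥ d+s+1, and let P ∈ P(d,n,s). Then f_i(P) ≥ C(d,i)·n − C(d+1,i+1)·i for every 1 ≤ i ≤ d−3, f_{d−2}(P) ≥ C(d,d−2)·n − C(d+1,d−1)·(d−2) − s, and f_{d−1}(P) ≥ (d−1)·n − (d+1)(d−2) − s. (Here C(a,b) denotes the binomial coefficient.) -/

import Mathlib

open Finset

namespace ASP

noncomputable section

/-- The dot product of two vectors in `ℝ^d`. -/
def dotp {d : ℕ} (x y : Fin d → ℝ) : ℝ := ∑ i, x i * y i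

/-- `F` is a face of the polytope `P ⊆ ℝ^d`: the intersection of `P` with a supporting
hyperplane, together with the empty face and `P` itself. -/
def IsFaceOf {d : ℕ} (P F : Set (Fin d → ℝ)) : Prop :=
  F = ∅ ∨ F = P ∨
    ∃ (b : Fin d → ℝ) (c : ℝ), b ≠ 0 ∧ (∀ x ∈ P, dotp b x ≤ c) ∧
      F = {x ∈ P | dotp b x = c}

/-- The dimension of a subset of `ℝ^d`: the dimension of its affine span. -/
def polyDim {d : ℕ} (S : Set (Fin d → ℝ)) : ℕ :=
  Module.finrank ℝ (affineSpan ℝ S).direction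

/-- A polytope: the convex hull of a finite point set. -/
def IsPolytope {d : ℕ} (P : Set (Fin d → ℝ)) : Prop :=
  ∃ V : Finset (Fin d → ℝ), P = convexHull ℝ (V : Set (Fin d → ℝ))

/-- The vertex set of a polytope: its set of extreme points. -/
def verts {d : ℕ} (P : Set (Fin d → ℝ)) : Set (Fin d → ℝ) :=
  Set.extremePoints ℝ P

/-- `fVec P i` is the number of `i`-dimensional (nonempty) faces of `P`. -/
def fVec {d : ℕ} (P : Set (Fin d → ℝ)) (i : ℕ) : ℕ :=
  {F : Set (Fin d → ℝ) | IsFaceOf P F ∧ F.Nonempty ∧ polyDim F = i}.ncard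

/-- A facet of a `d`-polytope in `ℝ^d`: a `(d-1)`-dimensional face. -/
def IsFacetOf {d : ℕ} (P F : Set (Fin d → ℝ)) : Prop :=
  IsFaceOf P F ∧ F.Nonempty ∧ polyDim F = d - 1

/-- `(P, F)` is an ASP-pair: `P` is a `d`-polytope, `F` is a facet of `P`, and every facet
of `P` other than `F` is a simplex (i.e. has exactly `d` vertices). -/
def IsASPPair {d : ℕ} (P F : Set (Fin d → ℝ)) : Prop :=
  IsPolytope P ∧ polyDim P = d ∧ IsFacetOf P F ∧
    ∀ G, IsFacetOf P G → G ≠ F → (verts G).ncard = d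

/-- `P ∈ 𝒫(d,n,s)`: `P` is a `d`-polytope with `n` vertices such that `(P,F)` is an
ASP-pair where the facet `F` has `d + s` vertices. -/
def MemASP (d n s : ℕ) (P : Set (Fin d → ℝ)) : Prop :=
  (verts P).ncard = n ∧ ∃ F, IsASPPair P F ∧ (verts F).ncard = d + s

/-- `fBall P i` is `f_{i-1}(P')` of the simplicial ball `P' = ∂P - {F}` consisting of all
proper faces of `P` except its (unique non-simplex) facet `F`; the index is shifted by one,
so `fBall P 0 = f_{-1} = 1` counts the empty face, and at the top dimension the facet `F`
is discarded. -/
def fBall {d : ℕ} (P : Set (Fin d → ℝ)) (i : ℕ) : ℤ :=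
  if i = 0 then 1
  else if i = d then (fVec P (d - 1) : ℤ) - 1
  else if d < i then 0
  else (fVec P (i - 1) : ℤ)

/-- `hBall P k` is `h_k(P')` of the `(d-1)`-dimensional ball `P' = ∂P - {F}`, defined by
`h_k = ∑_{i=0}^{k} (-1)^{k-i} C(d-i, k-i) f_{i-1}(P')`, extended by `0` outside `0 ≤ k ≤ d`. -/
def hBall {d : ℕ} (P : Set (Fin d → ℝ)) (k : ℤ) : ℤ :=
  if 0 ≤ k ∧ k ≤ (d : ℤ) then
    ∑ i ∈ Finset.range (k.toNat + 1),
      (-1) ^ (k.toNat - i) * ((d - i).choose (k.toNat - i) : ℤ) * fBall P i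
  else 0

/-- `fBd m Q i` is `f_{i-1}(∂Q)` of the boundary complex of an `m`-polytope `Q ⊆ ℝ^d`
(a complex of dimension `m - 1`); the index is shifted by one. -/
def fBd {d : ℕ} (m : ℕ) (Q : Set (Fin d → ℝ)) (i : ℕ) : ℤ :=
  if i = 0 then 1 else if m + 1 ≤ i then 0 else (fVec Q (i - 1) : ℤ)

/-- `hBd m Q k` is `h_k(∂Q)` for the boundary complex of an `m`-polytope `Q ⊆ ℝ^d`, defined by
`h_k = ∑_{i=0}^{k} (-1)^{k-i} C(m-i, k-i) f_{i-1}(∂Q)`, extended by `0` outside `0 ≤ k ≤ m`. -/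
def hBd {d : ℕ} (m : ℕ) (Q : Set (Fin d → ℝ)) (k : ℤ) : ℤ :=
  if 0 ≤ k ∧ k ≤ (m : ℤ) then
    ∑ i ∈ Finset.range (k.toNat + 1),
      (-1) ^ (k.toNat - i) * ((m - i).choose (k.toNat - i) : ℤ) * fBd m Q i
  else 0

/-- `gBd m Q k = g_k(∂Q) = h_k(∂Q) - h_{k-1}(∂Q)`. -/
def gBd {d : ℕ} (m : ℕ) (Q : Set (Fin d → ℝ)) (k : ℤ) : ℤ :=
  hBd m Q k - hBd m Q (k - 1)

/-- The function `p(t) = (n-1)^{(t-1)(d-1)} · t(t+1)⋯(t+d+s-1)` (real exponentiation of the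
positive base `n-1`) used to define the almost cyclic polytope. -/
def acp (d n s : ℕ) (t : ℝ) : ℝ :=
  ((n : ℝ) - 1) ^ ((t - 1) * ((d : ℝ) - 1)) * ∏ l ∈ Finset.range (d + s), (t + l)

/-- The curve `y(t) = (t, t², …, t^{d-1}, p(t)) ∈ ℝ^d`. -/
def acy (d n s : ℕ) (t : ℝ) : Fin d → ℝ :=
  fun i => if (i : ℕ) + 1 = d then acp d n s t else t ^ ((i : ℕ) + 1)

/-- The parameter values `t_i = -s - d + i` for `i = 1, …, n` (here `0`-indexed:
`acT d s j = t_{j+1}`). -/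
def acT (d s j : ℕ) : ℝ := (j : ℝ) + 1 - s - d

/-- The `n` points `y(t_1), …, y(t_n)` on the curve `y` (`0`-indexed). -/
def acPoint (d n s : ℕ) (j : Fin n) : Fin d → ℝ := acy d n s (acT d s (j : ℕ))

/-- The almost cyclic polytope `C(d,n,s) = conv{y(t_1), …, y(t_n)}`. -/
def acPolytope (d n s : ℕ) : Set (Fin d → ℝ) :=
  convexHull ℝ (Set.range (acPoint d n s))

/-- The non-simplex facet `F = conv{y(t_1), …, y(t_{d+s})}` of the almost cyclic polytope. -/
def acFacet (d n s : ℕ) : Set (Fin d → ℝ) :=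
  convexHull ℝ (acPoint d n s '' {j : Fin n | (j : ℕ) < d + s})

/-- The generalized moment curve
`x(t) = (t, t², …, t^{d-r}, p_1(t), …, p_r(t)) ∈ ℝ^d`. -/
def gmc (d r : ℕ) (p : Fin r → ℝ → ℝ) (t : ℝ) : Fin d → ℝ :=
  fun i =>
    if h : (i : ℕ) < d - r then t ^ ((i : ℕ) + 1)
    else p ⟨(i : ℕ) - (d - r), by have h2 := i.2; omega⟩ t

/-- A polytope is `k`-neighborly if each subset of at most `k` of its vertices is the
vertex set of a face. -/
def IsNeighborly {d : ℕ} (k : ℕ) (P : Set (Fin d → ℝ)) : Prop :=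
  ∀ S : Finset (Fin d → ℝ), (S : Set (Fin d → ℝ)) ⊆ verts P → S.card ≤ k →
    ∃ G : Set (Fin d → ℝ), IsFaceOf P G ∧ verts G = (S : Set (Fin d → ℝ))

/-- The point `y` is beyond the facet `F` of the polytope `P`: for every supporting
hyperplane of `P` cutting out a facet, `y` is strictly on the outer side if the facet is `F`,
and strictly on the inner side otherwise. -/
def IsBeyond {d : ℕ} (P F : Set (Fin d → ℝ)) (y : Fin d → ℝ) : Prop :=
  ∀ (b : Fin d → ℝ) (c : ℝ), b ≠ 0 → (∀ x ∈ P, dotp b x ≤ c) →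
    IsFacetOf P {x ∈ P | dotp b x = c} →
      (({x ∈ P | dotp b x = c} = F → c < dotp b y) ∧
       ({x ∈ P | dotp b x = c} ≠ F → dotp b y < c))

section comb
variable {α : Type*} [DecidableEq α]

/-- `τ` is a face of the complex generated by `B`. -/
def IsFc (B : Finset (Finset α)) (τ : Finset α) : Prop := ∃ σ ∈ B, τ ⊆ σ

/-- Faces with `k` vertices. -/
def fc (B : Finset (Finset α)) (k : ℕ) : Finset (Finset α) := B.biUnion (powersetCard k)

/-- Vertex set. -/
def vs (B : Finset (Finset α)) : Finset α := B.biUnion id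

/-- Link of a vertex. -/
def lk (B : Finset (Finset α)) (v : α) : Finset (Finset α) :=
  (B.filter (fun σ => v ∈ σ)).image (fun σ => σ.erase v)

theorem IsFc.mono {B : Finset (Finset α)} {τ τ' : Finset α} (h : IsFc B τ) (h' : τ' ⊆ τ) :
    IsFc B τ' := by
  obtain ⟨σ, h1, h2⟩ := h
  exact ⟨σ, h1, h'.trans h2⟩

theorem mem_fc {B : Finset (Finset α)} {k : ℕ} {τ : Finset α} :
    τ ∈ fc B k ↔ IsFc B τ ∧ τ.card = k := by
  simp only [fc, mem_biUnion, mem_powersetCard, IsFc]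
  constructor
  · rintro ⟨σ, h1, h2, h3⟩; exact ⟨⟨σ, h1, h2⟩, h3⟩
  · rintro ⟨⟨σ, h1, h2⟩, h3⟩; exact ⟨σ, h1, h2, h3⟩

theorem mem_vs {B : Finset (Finset α)} {v : α} : v ∈ vs B ↔ IsFc B {v} := by
  simp [vs, IsFc]

theorem IsFc.mem_vs {B : Finset (Finset α)} {τ : Finset α} (h : IsFc B τ) {v : α} (hv : v ∈ τ) :
    v ∈ vs B := ASP.mem_vs.2 (h.mono (by simpa using hv))

theorem mem_lk {B : Finset (Finset α)} {v : α} {ρ : Finset α} :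
    ρ ∈ lk B v ↔ v ∉ ρ ∧ insert v ρ ∈ B := by
  simp only [lk, mem_image, mem_filter]
  constructor
  · rintro ⟨σ, ⟨h1, h2⟩, rfl⟩
    exact ⟨by simp, by rwa [insert_erase h2]⟩
  · rintro ⟨h1, h2⟩
    exact ⟨_, ⟨h2, by simp⟩, by simp [h1]⟩

theorem isFc_lk {B : Finset (Finset α)} {v : α} {τ : Finset α} :
    IsFc (lk B v) τ ↔ v ∉ τ ∧ IsFc B (insert v τ) := by
  constructor
  · rintro ⟨ρ, h1, h2⟩
    rw [mem_lk] at h1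
    exact ⟨fun h => h1.1 (h2 h), _, h1.2, insert_subset_insert _ h2⟩
  · rintro ⟨h1, σ, h2, h3⟩
    have hv : v ∈ σ := h3 (by simp)
    refine ⟨σ.erase v, mem_lk.2 ⟨by simp, by rwa [insert_erase hv]⟩, ?_⟩
    intro x hx
    exact mem_erase.2 ⟨fun h => h1 (h ▸ hx), h3 (by simp [hx])⟩

theorem mem_vs_lk {B : Finset (Finset α)} {v u : α} :
    u ∈ vs (lk B v) ↔ u ≠ v ∧ IsFc B {v, u} := by
  rw [mem_vs, isFc_lk]
  simp only [mem_singleton]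
  exact and_congr_left fun _ => ⟨fun h h' => h h'.symm, fun h h' => h h'.symm⟩

theorem card_lk_filter {B : Finset (Finset α)} {v : α} {ρ : Finset α} (hv : v ∉ ρ) :
    ((lk B v).filter (fun σ => ρ ⊆ σ)).card = (B.filter (fun σ => insert v ρ ⊆ σ)).card := by
  refine card_bij' (fun σ _ => insert v σ) (fun σ _ => σ.erase v) ?_ ?_ ?_ ?_
  · intro σ h
    rw [mem_filter, mem_lk] at h
    exact mem_filter.2 ⟨h.1.2, insert_subset_insert _ h.2⟩
  · intro σ h
    rw [mem_filter] at h
    have hvσ : v ∈ σ := h.2 (by simp)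
    refine mem_filter.2 ⟨mem_lk.2 ⟨by simp, by rw [insert_erase hvσ]; exact h.1⟩, ?_⟩
    intro x hx
    exact mem_erase.2 ⟨fun h => hv (h ▸ hx), h.2 (by simp [hx])⟩
  · intro σ h
    rw [mem_filter, mem_lk] at h
    simp [h.1.1]
  · intro σ h
    rw [mem_filter] at h
    exact insert_erase (h.2 (by simp))

theorem card_fc_lk {B : Finset (Finset α)} {v : α} {k : ℕ} :
    (fc (lk B v) k).card = ((fc B (k + 1)).filter (fun τ => v ∈ τ)).card := by
  refine card_bij' (fun σ _ => insert v σ) (fun σ _ => σ.erase v) ?_ ?_ ?_ ?_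
  · intro σ h
    rw [mem_fc, isFc_lk] at h
    refine mem_filter.2 ⟨mem_fc.2 ⟨h.1.2, ?_⟩, by simp⟩
    rw [card_insert_of_notMem h.1.1, h.2]
  · intro σ h
    rw [mem_filter, mem_fc] at h
    refine mem_fc.2 ⟨isFc_lk.2 ⟨by simp, by rw [insert_erase h.2]; exact h.1.1⟩, ?_⟩
    rw [card_erase_of_mem h.2, h.1.2]; rfl
  · intro σ h
    rw [mem_fc, isFc_lk] at h
    simp [h.1.1]
  · intro σ h
    rw [mem_filter] at h
    exact insert_erase h.2

theorem sum_fc_lk (B : Finset (Finset α)) (k : ℕ) :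
    ∑ v ∈ vs B, (fc (lk B v) k).card = (k + 1) * (fc B (k + 1)).card := by
  simp_rw [card_fc_lk]
  have := sum_card_bipartiteAbove_eq_sum_card_bipartiteBelow (s := vs B) (t := fc B (k+1))
    (fun v τ => v ∈ τ)
  simp only [bipartiteAbove, bipartiteBelow] at this
  rw [this, mul_comm, ← smul_eq_mul, ← sum_const]
  refine sum_congr rfl fun τ hτ => ?_
  rw [mem_fc] at hτ
  rw [← hτ.2]
  congr 1
  ext v
  simp only [mem_filter]
  exact ⟨fun h => h.2, fun h => ⟨hτ.1.mem_vs h, h⟩⟩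

theorem card_fc_one (B : Finset (Finset α)) : (fc B 1).card = (vs B).card := by
  symm
  refine card_bij (fun v _ => {v}) ?_ ?_ ?_
  · intro v hv
    exact mem_fc.2 ⟨mem_vs.1 hv, by simp⟩
  · intro a _ b _ h; simpa using h
  · intro τ hτ
    rw [mem_fc, card_eq_one] at hτ
    obtain ⟨h, v, rfl⟩ := hτ
    exact ⟨v, mem_vs.2 h, rfl⟩

theorem sum_deg (B : Finset (Finset α)) :
    ∑ v ∈ vs B, (vs (lk B v)).card = 2 * (fc B 2).card := by
  rw [← sum_fc_lk B 1]
  exact sum_congr rfl fun v _ => (card_fc_one _).symm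

/-- Normal pseudomanifold (with boundary ridges those contained in `W`). -/
structure PM (d : ℕ) (B : Finset (Finset α)) (W : Finset α) : Prop where
  ne : B.Nonempty
  card : ∀ σ ∈ B, σ.card = d
  nW : ∀ σ ∈ B, ¬ σ ⊆ W
  ridge2 : ∀ ρ, ρ.card + 1 = d → IsFc B ρ → ¬ ρ ⊆ W →
    (B.filter (fun σ => ρ ⊆ σ)).card = 2
  conn : ∀ τ, τ.card + 2 ≤ d → IsFc B τ → ∀ A : Set α,
    (∀ x y, x ≠ y → x ∉ τ → y ∉ τ → (τ ⊆ W → x ∉ W ∧ y ∉ W) →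
      IsFc B (insert x (insert y τ)) → x ∈ A → y ∈ A) →
    ∀ x y, x ∉ τ → y ∉ τ → (τ ⊆ W → x ∉ W ∧ y ∉ W) →
      IsFc B (insert x τ) → IsFc B (insert y τ) → x ∈ A → y ∈ A

theorem fc_top {d : ℕ} {B : Finset (Finset α)} (h : ∀ σ ∈ B, σ.card = d) : fc B d = B := by
  ext τ
  rw [mem_fc]
  constructor
  · rintro ⟨⟨σ, h1, h2⟩, h3⟩
    rwa [eq_of_subset_of_card_le h2 (by rw [h σ h1, h3])]
  · intro hτ; exact ⟨⟨τ, hτ, Subset.rfl⟩, h τ hτ⟩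

theorem conn_aux {B : Finset (Finset α)} {v x y : α} {τ : Finset α} :
    insert x (insert y (insert v τ)) = insert v (insert x (insert y τ)) := by
  ext z; simp only [mem_insert]; tauto

theorem PM.link_in {d : ℕ} {B : Finset (Finset α)} {W : Finset α} (h : PM (d + 1) B W) {v : α}
    (hv : v ∈ vs B) (hW : v ∈ W) : PM d (lk B v) W where
  ne := by
    obtain ⟨σ, h1, h2⟩ := mem_vs.1 hv
    exact ⟨σ.erase v, mem_lk.2 ⟨by simp, by rwa [insert_erase (by simpa using h2)]⟩⟩
  card := fun σ hσ => by
    rw [mem_lk] at hσ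
    have := h.card _ hσ.2
    rw [card_insert_of_notMem hσ.1] at this; omega
  nW := fun σ hσ hs => by
    rw [mem_lk] at hσ
    exact h.nW _ hσ.2 (insert_subset hW hs)
  ridge2 := fun ρ h1 h2 h3 => by
    rw [isFc_lk] at h2
    rw [card_lk_filter h2.1]
    refine h.ridge2 _ (by rw [card_insert_of_notMem h2.1, h1]) h2.2 ?_
    exact fun h' => h3 ((subset_insert _ _).trans h')
  conn := fun τ h1 h2 A hA x y hx hy hxy hxf hyf hxA => by
    rw [isFc_lk] at h2 hxf hyf
    have e : ∀ z, insert z (insert v τ) = insert v (insert z τ) := fun z => insert_comm _ _ _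
    refine h.conn (insert v τ) (by rw [card_insert_of_notMem h2.1]; omega) h2.2 A ?_ x y ?_ ?_ ?_
      (by rw [e]; exact hxf.2) (by rw [e]; exact hyf.2) hxA
    · intro x y n1 n2 n3 n4 n5 n6
      simp only [mem_insert, not_or] at n2 n3
      refine hA x y n1 n2.2 n3.2 (fun hh => n4 (insert_subset hW hh)) ?_ n6
      rw [conn_aux (B := B)] at n5
      refine isFc_lk.2 ⟨?_, n5⟩
      simp only [mem_insert, not_or]
      exact ⟨fun h => n2.1 h.symm, fun h => n3.1 h.symm, h2.1⟩
    · simp only [mem_insert, not_or] at *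
      exact ⟨fun h => hxf.1.1 h.symm, hx⟩
    · simp only [mem_insert, not_or] at *
      exact ⟨fun h => hyf.1.1 h.symm, hy⟩
    · exact fun hh => hxy ((subset_insert _ _).trans hh)

theorem PM.link_out {d : ℕ} {B : Finset (Finset α)} {W : Finset α} (h : PM (d + 1) B W) {v : α}
    (hv : v ∈ vs B) (hW : v ∉ W) (hd : 1 ≤ d) : PM d (lk B v) ∅ where
  ne := by
    obtain ⟨σ, h1, h2⟩ := mem_vs.1 hv
    exact ⟨σ.erase v, mem_lk.2 ⟨by simp, by rwa [insert_erase (by simpa using h2)]⟩⟩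
  card := fun σ hσ => by
    rw [mem_lk] at hσ
    have := h.card _ hσ.2
    rw [card_insert_of_notMem hσ.1] at this; omega
  nW := fun σ hσ hs => by
    rw [mem_lk] at hσ
    have := h.card _ hσ.2
    rw [card_insert_of_notMem hσ.1, subset_empty.1 hs] at this
    simp at this; omega
  ridge2 := fun ρ h1 h2 h3 => by
    rw [isFc_lk] at h2
    rw [card_lk_filter h2.1]
    exact h.ridge2 _ (by rw [card_insert_of_notMem h2.1, h1]) h2.2
      (fun h' => hW (h' (by simp)))
  conn := fun τ h1 h2 A hA x y hx hy hxy hxf hyf hxA => by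
    rw [isFc_lk] at h2 hxf hyf
    have e : ∀ z, insert z (insert v τ) = insert v (insert z τ) := fun z => insert_comm _ _ _
    refine h.conn (insert v τ) (by rw [card_insert_of_notMem h2.1]; omega) h2.2 A ?_ x y ?_ ?_ ?_
      (by rw [e]; exact hxf.2) (by rw [e]; exact hyf.2) hxA
    · intro x y n1 n2 n3 n4 n5 n6
      simp only [mem_insert, not_or] at n2 n3
      refine hA x y n1 n2.2 n3.2 (fun hh => by simp) ?_ n6
      rw [conn_aux (B := B)] at n5
      refine isFc_lk.2 ⟨?_, n5⟩
      simp only [mem_insert, not_or]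
      exact ⟨fun h => n2.1 h.symm, fun h => n3.1 h.symm, h2.1⟩
    · simp only [mem_insert, not_or] at *
      exact ⟨fun h => hxf.1.1 h.symm, hx⟩
    · simp only [mem_insert, not_or] at *
      exact ⟨fun h => hyf.1.1 h.symm, hy⟩
    · exact fun hh => absurd (hh (by simp)) hW

/-- global connectivity -/
theorem PM.conn0 {d : ℕ} {B : Finset (Finset α)} {W : Finset α} (h : PM d B W) (hd : 2 ≤ d)
    (A : Set α) (hA : ∀ x y, x ≠ y → x ∉ W → y ∉ W → IsFc B {x, y} → x ∈ A → y ∈ A)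
    {x y : α} (hx : x ∈ vs B) (hy : y ∈ vs B) (hxW : x ∉ W) (hyW : y ∉ W) (hxA : x ∈ A) :
    y ∈ A := by
  obtain ⟨σ, hσ⟩ := h.ne
  refine h.conn ∅ (by simpa using hd) ⟨σ, hσ, by simp⟩ A ?_ x y (by simp) (by simp)
    (fun _ => ⟨hxW, hyW⟩) (by simpa using mem_vs.1 hx) (by simpa using mem_vs.1 hy) hxA
  intro x y n1 _ _ n4 n5 n6
  exact hA x y n1 (n4 (by simp)).1 (n4 (by simp)).2 (by simpa using n5) n6

/-- Main growth step. -/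
theorem grow {d : ℕ} (hd : 2 ≤ d)
    (IH : ∀ (B : Finset (Finset α)), PM d B ∅ → ∀ O : Finset α, (∃ σ ∈ B, σ ⊆ O) →
      d * (vs B \ O).card ≤ ((fc B 2).filter (fun e => ¬ e ⊆ O)).card)
    (B : Finset (Finset α)) (W : Finset α) (h : PM (d + 1) B W) :
    ∀ (N : ℕ) (O : Finset α), (vs B \ O).card = N → (∃ σ ∈ B, σ ⊆ O) →
      (d + 1) * (vs B \ (O ∪ W)).card + ((vs B ∩ W) \ O).card ≤
        ((fc B 2).filter (fun e => ¬ e ⊆ W ∧ ¬ e ⊆ O)).card := by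
  intro N
  induction N using Nat.strong_induction_on with
  | _ N ih =>
  intro O hN hO
  by_cases hsub : vs B ⊆ O
  · have e1 : vs B \ (O ∪ W) = ∅ := sdiff_eq_empty_iff_subset.2 (hsub.trans subset_union_left)
    have e2 : (vs B ∩ W) \ O = ∅ := sdiff_eq_empty_iff_subset.2 (inter_subset_left.trans hsub)
    rw [e1, e2]; simp
  obtain ⟨w, hwW, ⟨σ, hσ, hwσ, hσO⟩, hwlk⟩ : ∃ w, w ∉ W ∧ (∃ σ ∈ B, w ∈ σ ∧ σ ⊆ O) ∧
      ¬ vs (lk B w) ⊆ O := by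
    by_contra hcon
    push Not at hcon
    apply hsub
    obtain ⟨σ0, hσ0, hσ0O⟩ := hO
    obtain ⟨w0, hw0, hw0W⟩ := not_subset.1 (h.nW _ hσ0)
    have key : ∀ y ∈ vs B, y ∉ W → ∃ σ ∈ B, y ∈ σ ∧ σ ⊆ O := by
      intro y hy hyW
      refine h.conn0 (by omega) {y | ∃ σ ∈ B, y ∈ σ ∧ σ ⊆ O} ?_
        (IsFc.mem_vs ⟨σ0, hσ0, Subset.rfl⟩ hw0) hy hw0W hyW ⟨σ0, hσ0, hw0, hσ0O⟩
      rintro x y hxy hx hy ⟨σ, hσ, hsub⟩ hxA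
      refine ⟨σ, hσ, hsub (by simp), ?_⟩
      obtain ⟨σ1, hσ1, hx1, hσ1O⟩ := hxA
      intro z hz
      by_cases hzx : z = x
      · subst hzx; exact hσ1O hx1
      · refine hcon x hx ⟨σ1, hσ1, hx1, hσ1O⟩ (mem_vs_lk.2 ⟨hzx, σ, hσ, ?_⟩)
        have : x ∈ σ := hsub (by simp)
        simp [insert_subset_iff, this, hz]
    intro u hu
    obtain ⟨τ, hτ, huτ⟩ := mem_vs.1 hu
    obtain ⟨w1, hw1, hw1W⟩ := not_subset.1 (h.nW _ hτ)
    obtain ⟨σ1, hσ1, hx1, hσ1O⟩ := key w1 (IsFc.mem_vs ⟨τ, hτ, Subset.rfl⟩ hw1) hw1W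
    by_cases huw : u = w1
    · subst huw; exact hσ1O hx1
    · refine hcon w1 hw1W ⟨σ1, hσ1, hx1, hσ1O⟩ (mem_vs_lk.2 ⟨huw, τ, hτ, ?_⟩)
      rw [insert_subset_iff]; exact ⟨hw1, huτ⟩
  have hwO : w ∈ O := hσO hwσ
  have hwv : w ∈ vs B := IsFc.mem_vs ⟨σ, hσ, Subset.rfl⟩ hwσ
  set L := vs (lk B w) with hL
  have hLv : L ⊆ vs B := by
    intro u hu
    exact (mem_vs_lk.1 hu).2.mem_vs (by simp)
  set O' := O ∪ L with hO'
  have hlt : (vs B \ O').card < N := by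
    rw [← hN]
    apply card_lt_card
    obtain ⟨u, hu, huO⟩ := not_subset.1 hwlk
    refine ⟨fun x hx => ?_, fun hh => ?_⟩
    · simp only [hO', mem_sdiff, mem_union, not_or] at hx ⊢
      exact ⟨hx.1, hx.2.1⟩
    · have := hh (mem_sdiff.2 ⟨hLv hu, huO⟩)
      simp [hO', hu] at this
  have ih' := ih _ hlt O' rfl ⟨σ, hσ, hσO.trans subset_union_left⟩
  have hlink := IH (lk B w) (h.link_out hwv hwW (by omega)) (O ∪ W)
    ⟨σ.erase w, mem_lk.2 ⟨by simp, by rwa [insert_erase hwσ]⟩,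
      (erase_subset _ _).trans (hσO.trans subset_union_left)⟩
  rw [← hL] at hlink
  -- the three families of edges
  set E1 := (fc B 2).filter (fun e => ¬ e ⊆ W ∧ ¬ e ⊆ O') with hE1
  set E2 := (fc (lk B w) 2).filter (fun e => ¬ e ⊆ O ∪ W) with hE2
  set E3 := (L \ O).image (fun u => ({w, u} : Finset α)) with hE3
  have cE3 : E3.card = (L \ O).card := by
    apply card_image_of_injOn
    intro a ha b hb hab
    simp only [coe_sdiff, Set.mem_sdiff, mem_coe] at ha hb
    have hab' : ({w, a} : Finset α) = {w, b} := hab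
    have : a ∈ ({w, b} : Finset α) := by rw [← hab']; simp
    simp only [mem_insert, mem_singleton] at this
    rcases this with rfl | h
    · exact absurd hwO ha.2
    · exact h
  have hsubE : E1 ∪ (E2 ∪ E3) ⊆ (fc B 2).filter (fun e => ¬ e ⊆ W ∧ ¬ e ⊆ O) := by
    intro e he
    simp only [mem_union] at he
    rcases he with he | he | he
    · simp only [hE1, mem_filter] at he ⊢
      exact ⟨he.1, he.2.1, fun hh => he.2.2 (hh.trans subset_union_left)⟩
    · simp only [hE2, mem_filter, mem_fc, isFc_lk] at he ⊢
      exact ⟨⟨he.1.1.2.mono (subset_insert _ _), he.1.2⟩,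
        fun hh => he.2 (hh.trans subset_union_right),
        fun hh => he.2 (hh.trans subset_union_left)⟩
    · simp only [hE3, mem_image, mem_sdiff] at he
      obtain ⟨u, ⟨hu1, hu2⟩, rfl⟩ := he
      have hu := mem_vs_lk.1 hu1
      refine mem_filter.2 ⟨mem_fc.2 ⟨hu.2, card_pair hu.1.symm⟩, ?_, ?_⟩
      · exact fun hh => hwW (hh (by simp))
      · exact fun hh => hu2 (hh (by simp))
  have d23 : Disjoint E2 E3 := by
    rw [disjoint_left]
    intro e he he'
    simp only [hE2, mem_filter, mem_fc, isFc_lk] at he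
    simp only [hE3, mem_image] at he'
    obtain ⟨u, _, rfl⟩ := he'
    exact he.1.1.1 (by simp)
  have d1 : Disjoint E1 (E2 ∪ E3) := by
    rw [disjoint_left]
    intro e he he'
    simp only [hE1, mem_filter] at he
    apply he.2.2
    rcases mem_union.1 he' with h2 | h3
    · simp only [hE2, mem_filter, mem_fc] at h2
      intro x hx
      exact mem_union_right _ (h2.1.1.mem_vs hx)
    · simp only [hE3, mem_image, mem_sdiff] at h3
      obtain ⟨u, ⟨hu1, _⟩, rfl⟩ := h3
      simp [insert_subset_iff, hO', hwO, hu1]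
  have hcard := card_le_card hsubE
  rw [card_union_of_disjoint d1, card_union_of_disjoint d23, cE3] at hcard
  have s1 : (vs B \ (O ∪ W)).card = (vs B \ (O' ∪ W)).card + (L \ (O ∪ W)).card := by
    rw [← card_union_of_disjoint]
    · congr 1; ext x
      have := @hLv x
      simp only [mem_sdiff, mem_union, hO']
      tauto
    · rw [disjoint_left]; intro x
      simp only [mem_sdiff, mem_union, hO']
      tauto
  have s2 : ((vs B ∩ W) \ O).card = ((vs B ∩ W) \ O').card + ((L ∩ W) \ O).card := by
    rw [← card_union_of_disjoint]
    · congr 1; ext x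
      have := @hLv x
      simp only [mem_sdiff, mem_union, hO', mem_inter]
      tauto
    · rw [disjoint_left]; intro x
      simp only [mem_sdiff, mem_union, hO', mem_inter]
      tauto
  have s3 : (L \ O).card = (L \ (O ∪ W)).card + ((L ∩ W) \ O).card := by
    rw [← card_union_of_disjoint]
    · congr 1; ext x
      simp only [mem_sdiff, mem_union, mem_inter]
      tauto
    · rw [disjoint_left]; intro x
      simp only [mem_sdiff, mem_union, mem_inter]
      tauto
  rw [s1, s2]
  rw [s3] at hcard
  nlinarith
end comb

section comb2
variable {α : Type*} [DecidableEq α]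

theorem rank_ineq {ι ε θ : Type*} [Fintype ι] [Fintype ε] [Fintype θ] [DecidableEq ι]
    [DecidableEq ε] [DecidableEq θ]
    (A : Matrix ι ε (ZMod 2)) (M : Matrix ε θ (ZMod 2)) (h0 : A * M = 0)
    (hA : ∀ y, Matrix.mulVec A.transpose y = 0 → y = 0)
    (hM : ∀ x, Matrix.mulVec M x = 0 → ∀ t t', x t = x t') :
    Fintype.card θ + Fintype.card ι ≤ Fintype.card ε + 1 := by
  have h1 := Matrix.rank_add_rank_le_card_of_mul_eq_zero h0
  have h2 : A.rank = Fintype.card ι := by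
    rw [← Matrix.rank_transpose]
    have := LinearMap.finrank_range_of_inj (f := A.transpose.mulVecLin) (by
      rw [← LinearMap.ker_eq_bot, LinearMap.ker_eq_bot']
      intro y hy; exact hA y hy)
    rw [Matrix.rank, this, Module.finrank_fintype_fun_eq_card]
  have h3 : Fintype.card θ ≤ M.rank + 1 := by
    have := LinearMap.finrank_range_add_finrank_ker M.mulVecLin
    rw [Module.finrank_fintype_fun_eq_card] at this
    have hk : Module.finrank (ZMod 2) (LinearMap.ker M.mulVecLin) ≤ 1 := by
      have hle : LinearMap.ker M.mulVecLin ≤ Submodule.span (ZMod 2) {fun _ => 1} := by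
        intro x hx
        rw [LinearMap.mem_ker] at hx
        have hc := hM x hx
        rw [Submodule.mem_span_singleton]
        by_cases hθ : Nonempty θ
        · obtain ⟨t⟩ := hθ
          exact ⟨x t, by ext t'; simp [hc t t']⟩
        · exact ⟨0, by ext t'; exact absurd ⟨t'⟩ hθ⟩
      refine (Submodule.finrank_mono hle).trans ?_
      refine (finrank_span_le_card _).trans (by simp)
    rw [Matrix.rank]; omega
  omega

theorem zmod2_add {a b : ZMod 2} (h : a + b = 0) : a = b := by
  revert a b; decide

/-- edges inside a triangle through a vertex -/
theorem card_edges_through {t : Finset α} (ht : t.card = 3) {v : α} (hv : v ∈ t) :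
    ((powersetCard 2 t).filter (fun e => v ∈ e)).card = 2 := by
  have : (powersetCard 2 t).filter (fun e => v ∈ e) = (t.erase v).image (fun u => {v, u}) := by
    ext e
    simp only [mem_filter, mem_powersetCard, mem_image, mem_erase]
    constructor
    · rintro ⟨⟨h1, h2⟩, h3⟩
      obtain ⟨a, b, hab, rfl⟩ := card_eq_two.1 h2
      simp only [mem_insert, mem_singleton] at h3
      rcases h3 with rfl | rfl
      · exact ⟨b, ⟨hab.symm, h1 (by simp)⟩, rfl⟩
      · exact ⟨a, ⟨hab, h1 (by simp)⟩, pair_comm _ _⟩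
    · rintro ⟨u, ⟨h1, h2⟩, rfl⟩
      exact ⟨⟨by simp [insert_subset_iff, hv, h2], card_pair h1.symm⟩, by simp⟩
  rw [this, card_image_of_injOn, card_erase_of_mem hv, ht]
  intro a ha b hb hab
  have hab' : ({v, a} : Finset α) = {v, b} := hab
  have : a ∈ ({v, b} : Finset α) := by rw [← hab']; simp
  simp only [mem_insert, mem_singleton] at this
  rcases this with rfl | h
  · simp at ha
  · exact h

/-- `e` meets `C`. -/
def Tch (C e : Finset α) : Prop := ¬ Disjoint e C

instance (C : Finset α) : DecidablePred (Tch C) := fun e => by unfold Tch; infer_instance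

theorem tch_iff {C e : Finset α} : Tch C e ↔ ∃ v ∈ e, v ∈ C := not_disjoint_iff

theorem Tch.mono {C e f : Finset α} (h : Tch C e) (hf : e ⊆ f) : Tch C f := by
  rw [tch_iff] at *
  obtain ⟨v, h1, h2⟩ := h
  exact ⟨v, hf h1, h2⟩

theorem euler3 {B : Finset (Finset α)} {W C : Finset α} (h : PM 3 B W)
    (hCW : ∀ v ∈ C, v ∉ W)
    (hconn : ∀ S : Set α, (∀ x ∈ C, ∀ y ∈ C, x ≠ y → IsFc B {x, y} → x ∈ S → y ∈ S) →
      ∀ x ∈ C, ∀ y ∈ C, x ∈ S → y ∈ S)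
    (hout : ∃ x ∈ C, ∃ y, y ∉ C ∧ IsFc B {x, y}) :
    (B.filter (Tch C)).card + C.card ≤ ((fc B 2).filter (Tch C)).card + 1 := by
  set T := B.filter (Tch C) with hT
  set E := (fc B 2).filter (Tch C) with hE
  have := rank_ineq (ι := C) (ε := E) (θ := T)
    (Matrix.of fun v e => if v.1 ∈ e.1 then 1 else 0)
    (Matrix.of fun e t => if e.1 ⊆ t.1 then 1 else 0) ?_ ?_ ?_
  · simpa using this
  · ext v t
    obtain ⟨v, hv⟩ := v
    obtain ⟨t, ht⟩ := t
    rw [Matrix.mul_apply]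
    simp only [Matrix.zero_apply, Matrix.of_apply]
    rw [Finset.sum_coe_sort E (fun e => (if v ∈ e then (1 : ZMod 2) else 0) * (if e ⊆ t then 1 else 0))]
    simp only [← ite_and, mul_ite, mul_one, mul_zero]
    rw [Finset.sum_boole]
    by_cases hvt : v ∈ t
    · have : E.filter (fun e => e ⊆ t ∧ v ∈ e) = (powersetCard 2 t).filter (fun e => v ∈ e) := by
        ext e
        simp only [hE, mem_filter, mem_fc, mem_powersetCard, tch_iff]
        constructor
        · rintro ⟨⟨⟨h1, h2⟩, h3⟩, h4, h5⟩; exact ⟨⟨h4, h2⟩, h5⟩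
        · rintro ⟨⟨h4, h2⟩, h5⟩
          exact ⟨⟨⟨⟨t, (mem_filter.1 ht).1, h4⟩, h2⟩, v, h5, hv⟩, h4, h5⟩
      rw [this, card_edges_through (h.card t (mem_filter.1 ht).1) hvt]
      rfl
    · have : E.filter (fun e => e ⊆ t ∧ v ∈ e) = ∅ := by
        ext e
        simp only [mem_filter, notMem_empty, iff_false]
        rintro ⟨_, h4, h5⟩; exact hvt (h4 h5)
      rw [this]; rfl
  · intro y hy
    have key : ∀ e ∈ E, ∑ v ∈ C.attach, (if v.1 ∈ e then y v else 0) = 0 := by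
      intro e he
      have := congrFun hy ⟨e, he⟩
      simpa [Matrix.mulVec, dotProduct, Matrix.transpose_apply] using this
    set Y : α → ZMod 2 := fun v => if hv : v ∈ C then y ⟨v, hv⟩ else 0 with hY
    have key2 : ∀ e ∈ E, ∑ v ∈ e, Y v = 0 := by
      intro e he
      rw [← key e he, ← Finset.sum_filter_of_ne (s := e) (p := fun v => v ∈ C)]
      · have e1 : ∑ v ∈ C.attach, (if v.1 ∈ e then y v else 0) =
            ∑ v ∈ C.attach, (fun v : α => if v ∈ e then Y v else 0) v.1 := by
          refine sum_congr rfl fun v _ => ?_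
          simp [hY]
        rw [e1, Finset.sum_attach C (fun v : α => if v ∈ e then Y v else 0), ← sum_filter]
        refine sum_congr ?_ fun _ _ => rfl
        ext v; simp only [mem_filter]; tauto
      · intro v hv hne
        by_contra hvC
        simp [hY, hvC] at hne
    have key3 : ∀ u v, u ≠ v → u ∈ C → IsFc B {u, v} → Y u = Y v := by
      intro u v huv hu huvf
      have := key2 {u, v} (mem_filter.2 ⟨mem_fc.2 ⟨huvf, card_pair huv⟩, tch_iff.2 ⟨u, by simp, hu⟩⟩)
      rw [sum_pair huv] at this
      exact zmod2_add this
    obtain ⟨x, hx, z, hz, hxz⟩ := hout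
    have hYx : Y x = 0 := by
      rw [key3 x z (fun h => hz (h ▸ hx)) hx hxz]; simp [hY, hz]
    ext ⟨v, hv⟩
    have := hconn {v | Y v = 0} (fun a ha b hb hab hf hYa => by
      rw [Set.mem_ofPred_eq] at *; rw [← key3 a b hab ha hf]; exact hYa) x hx v hv hYx
    simpa [hY, hv] using this
  · intro x hx
    have key : ∀ e ∈ E, ∑ t ∈ T.attach, (if e ⊆ t.1 then x t else 0) = 0 := by
      intro e he
      have := congrFun hx ⟨e, he⟩
      simpa [Matrix.mulVec, dotProduct] using this
    set Y : Finset α → ZMod 2 := fun v => if hv : v ∈ T then x ⟨v, hv⟩ else 0 with hY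
    have key2 : ∀ e ∈ E, ∑ t ∈ B.filter (fun t => e ⊆ t), Y t = 0 := by
      intro e he
      rw [← key e he]
      have e1 : ∑ t ∈ T.attach, (if e ⊆ t.1 then x t else 0) =
            ∑ t ∈ T.attach, (fun t : Finset α => if e ⊆ t then Y t else 0) t.1 := by
          refine sum_congr rfl fun v _ => ?_
          simp [hY]
      rw [e1, Finset.sum_attach T (fun t : Finset α => if e ⊆ t then Y t else 0), ← sum_filter]
      refine sum_congr ?_ fun _ _ => rfl
      ext t; simp only [mem_filter, hT]
      constructor
      · rintro ⟨h1, h2⟩; exact ⟨⟨h1, (mem_filter.1 he).2.mono h2⟩, h2⟩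
      · rintro ⟨⟨h1, _⟩, h2⟩; exact ⟨h1, h2⟩
    have key3 : ∀ e ∈ E, ∀ t ∈ B, ∀ t' ∈ B, e ⊆ t → e ⊆ t' → Y t = Y t' := by
      intro e he t ht t' ht' h1 h2
      by_cases hne : t = t'
      · rw [hne]
      obtain ⟨he1, he2⟩ := mem_filter.1 he
      rw [mem_fc] at he1
      have hc := h.ridge2 e (by rw [he1.2]) he1.1 (fun hh => by
        obtain ⟨v, hv, hvC⟩ := tch_iff.1 he2
        exact hCW v hvC (hh hv))
      have hsub : ({t, t'} : Finset (Finset α)) = B.filter (fun σ => e ⊆ σ) := by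
        apply eq_of_subset_of_card_le
        · intro σ hσ
          simp only [mem_insert, mem_singleton] at hσ
          rcases hσ with rfl | rfl <;> simp [*]
        · rw [hc, card_pair hne]
      have := key2 e he
      rw [← hsub, sum_pair hne] at this
      exact zmod2_add this
    -- constant around a vertex
    have key4 : ∀ v ∈ C, ∀ t ∈ B, ∀ t' ∈ B, v ∈ t → v ∈ t' → Y t = Y t' := by
      intro v hv t ht t' ht' hvt hvt'
      have pick : ∀ t ∈ B, v ∈ t → ∃ u ∈ t, u ≠ v := by
        intro t ht hvt
        have : (t.erase v).Nonempty := by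
          rw [← card_pos, card_erase_of_mem hvt, h.card t ht]; norm_num
        obtain ⟨u, hu⟩ := this
        exact ⟨u, (mem_erase.1 hu).2, (mem_erase.1 hu).1⟩
      obtain ⟨a, ha, hav⟩ := pick t ht hvt
      obtain ⟨b, hb, hbv⟩ := pick t' ht' hvt'
      have hEe : ∀ u t, t ∈ B → u ≠ v → u ∈ t → v ∈ t → ({v, u} : Finset α) ∈ E := by
        intro u t ht hu hut hvt
        exact mem_filter.2 ⟨mem_fc.2 ⟨⟨t, ht, by simp [insert_subset_iff, hut, hvt]⟩,
          card_pair hu.symm⟩, tch_iff.2 ⟨v, by simp, hv⟩⟩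
      have hvW := hCW v hv
      have hnW : ∀ {p : Prop}, (({v} : Finset α) ⊆ W → p) := fun hh => absurd (hh (by simp)) hvW
      have := h.conn {v} (by simp) ⟨t, ht, by simpa using hvt⟩
        {u | ∀ s ∈ B, v ∈ s → u ∈ s → Y s = Y t} ?_ a b (by simpa using hav) (by simpa using hbv)
        hnW ⟨t, ht, by simp [insert_subset_iff, ha, hvt]⟩
        ⟨t', ht', by simp [insert_subset_iff, hb, hvt']⟩ ?_
      · exact (this t' ht' hvt' hb).symm
      · rintro p q hpq hpv hqv - ⟨s, hs, hss⟩ hp s' hs' hvs' hqs'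
        simp only [insert_subset_iff, singleton_subset_iff] at hss
        rw [← hp s hs hss.2.2 hss.1]
        refine key3 {v, q} (hEe q s hs (by simpa using hqv) hss.2.1 hss.2.2) s' hs' s hs ?_ ?_ <;>
          simp [insert_subset_iff, *]
      · intro s hs hvs has
        refine key3 {v, a} (hEe a t ht hav ha hvt) s hs t ht ?_ ?_ <;>
          simp [insert_subset_iff, *]
    rintro ⟨t, ht⟩ ⟨t', ht'⟩
    obtain ⟨htB, htC⟩ := mem_filter.1 ht
    obtain ⟨htB', htC'⟩ := mem_filter.1 ht'
    obtain ⟨u, hut, huC⟩ := tch_iff.1 htC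
    obtain ⟨w, hwt, hwC⟩ := tch_iff.1 htC'
    have := hconn {v | ∀ s ∈ B, v ∈ s → Y s = Y t} ?_ u huC w hwC ?_
    · have := this t' htB' hwt
      simp only [hY, ht, ht', dif_pos] at this
      exact this.symm
    · rintro a ha b hb hab ⟨s, hs, hss⟩ hA s' hs' hbs'
      simp only [insert_subset_iff, singleton_subset_iff] at hss
      rw [← hA s hs hss.1]
      exact key4 b hb s' hs' s hs hbs' hss.2
    · intro s hs hus
      exact key4 u huC s hs t htB hus hut

theorem count3 {B : Finset (Finset α)} {W C : Finset α} (h : PM 3 B W)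
    (hCW : ∀ v ∈ C, v ∉ W) :
    2 * ((fc B 2).filter (Tch C)).card + (B.filter (fun t => (t ∩ C).card = 1)).card
      = 3 * (B.filter (Tch C)).card := by
  have dc := sum_card_bipartiteAbove_eq_sum_card_bipartiteBelow (s := (fc B 2).filter (Tch C))
    (t := B.filter (Tch C)) (fun e t => e ⊆ t)
  simp only [bipartiteAbove, bipartiteBelow] at dc
  have e1 : ∑ e ∈ (fc B 2).filter (Tch C), ((B.filter (Tch C)).filter (fun t => e ⊆ t)).card
      = 2 * ((fc B 2).filter (Tch C)).card := by
    rw [mul_comm, ← smul_eq_mul, ← sum_const]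
    refine sum_congr rfl fun e he => ?_
    obtain ⟨he1, he2⟩ := mem_filter.1 he
    rw [mem_fc] at he1
    rw [← h.ridge2 e (by rw [he1.2]) he1.1 (fun hh => by
        obtain ⟨v, hv, hvC⟩ := tch_iff.1 he2
        exact hCW v hvC (hh hv))]
    congr 1
    ext t
    simp only [mem_filter]
    constructor
    · rintro ⟨⟨h1, h2⟩, h3⟩; exact ⟨h1, h3⟩
    · rintro ⟨h1, h3⟩; exact ⟨⟨h1, he2.mono h3⟩, h3⟩
  have e2 : B.filter (fun t => (t ∩ C).card = 1) =
      (B.filter (Tch C)).filter (fun t => (t ∩ C).card = 1) := by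
    ext t
    simp only [mem_filter, tch_iff]
    constructor
    · rintro ⟨h1, h2⟩
      obtain ⟨v, hv⟩ := card_pos.1 (by rw [h2]; norm_num : 0 < (t ∩ C).card)
      exact ⟨⟨h1, v, (mem_inter.1 hv).1, (mem_inter.1 hv).2⟩, h2⟩
    · rintro ⟨⟨h1, _⟩, h2⟩; exact ⟨h1, h2⟩
  rw [← e1, dc, e2, card_filter, ← sum_add_distrib, mul_comm, ← smul_eq_mul, ← sum_const]
  refine sum_congr rfl fun t ht => ?_
  obtain ⟨htB, htC⟩ := mem_filter.1 ht
  have hc := h.card t htB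
  have e3 : ((fc B 2).filter (Tch C)).filter (fun e => e ⊆ t) =
      powersetCard 2 t \ powersetCard 2 (t \ C) := by
    ext e
    simp only [mem_filter, mem_fc, mem_sdiff, mem_powersetCard, tch_iff]
    constructor
    · rintro ⟨⟨⟨h1, h2⟩, v, h3, h4⟩, h5⟩
      exact ⟨⟨h5, h2⟩, fun hh => (mem_sdiff.1 (hh.1 h3)).2 h4⟩
    · rintro ⟨⟨h5, h2⟩, hh⟩
      refine ⟨⟨⟨⟨t, htB, h5⟩, h2⟩, ?_⟩, h5⟩
      by_contra hcon
      push Not at hcon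
      exact hh ⟨fun x hx => mem_sdiff.2 ⟨h5 hx, hcon x hx⟩, h2⟩
  rw [e3, card_sdiff_of_subset (powersetCard_mono sdiff_subset), card_powersetCard,
    card_powersetCard, hc]
  have e4 := card_inter_add_card_sdiff t C
  obtain ⟨v, hv, hvC⟩ := tch_iff.1 htC
  have e5 : 0 < (t ∩ C).card := card_pos.2 ⟨v, mem_inter.2 ⟨hv, hvC⟩⟩
  rw [hc] at e4
  have : (t ∩ C).card = 1 ∨ (t ∩ C).card = 2 ∨ (t ∩ C).card = 3 := by omega
  rcases this with h1 | h1 | h1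
  · have : (t \ C).card = 2 := by omega
    rw [this, h1]; decide
  · have : (t \ C).card = 1 := by omega
    rw [this, h1]; decide
  · have : (t \ C).card = 0 := by omega
    rw [this, h1]; decide

theorem lemma3 {B : Finset (Finset α)} {W C : Finset α} (h : PM 3 B W)
    (hCW : ∀ v ∈ C, v ∉ W)
    (hconn : ∀ S : Set α, (∀ x ∈ C, ∀ y ∈ C, x ≠ y → IsFc B {x, y} → x ∈ S → y ∈ S) →
      ∀ x ∈ C, ∀ y ∈ C, x ∈ S → y ∈ S)
    (hout : ∃ x ∈ C, ∃ y, y ∉ C ∧ IsFc B {x, y}) :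
    3 * C.card + (B.filter (fun t => (t ∩ C).card = 1)).card ≤
      ((fc B 2).filter (Tch C)).card + 3 := by
  have h1 := euler3 h hCW hconn hout
  have h2 := count3 h hCW
  omega

end comb2

section comb3
variable {α : Type*} [DecidableEq α]

theorem star_conn {B : Finset (Finset α)} {W : Finset α} (h : PM 3 B W) {v : α} (hvW : v ∉ W)
    (Q : Finset α → Prop)
    (hQ : ∀ u, u ≠ v → ∀ t ∈ B, ∀ t' ∈ B, v ∈ t → v ∈ t' → u ∈ t → u ∈ t' → Q t → Q t')
    {t t' : Finset α} (ht : t ∈ B) (ht' : t' ∈ B) (hvt : v ∈ t) (hvt' : v ∈ t') (h0 : Q t) :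
    Q t' := by
  have pick : ∀ t ∈ B, v ∈ t → ∃ u ∈ t, u ≠ v := by
    intro t ht hvt
    have : (t.erase v).Nonempty := by
      rw [← card_pos, card_erase_of_mem hvt, h.card t ht]; norm_num
    obtain ⟨u, hu⟩ := this
    exact ⟨u, (mem_erase.1 hu).2, (mem_erase.1 hu).1⟩
  obtain ⟨a, ha, hav⟩ := pick t ht hvt
  obtain ⟨b, hb, hbv⟩ := pick t' ht' hvt'
  have hnW : ∀ {p : Prop}, (({v} : Finset α) ⊆ W → p) := fun hh => absurd (hh (by simp)) hvW
  have := h.conn {v} (by simp) ⟨t, ht, by simpa using hvt⟩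
    {u | ∀ s ∈ B, v ∈ s → u ∈ s → Q s} ?_ a b (by simpa using hav) (by simpa using hbv)
    hnW ⟨t, ht, by simp [insert_subset_iff, ha, hvt]⟩
    ⟨t', ht', by simp [insert_subset_iff, hb, hvt']⟩ ?_
  · exact (this t' ht' hvt' hb)
  · rintro p q hpq hpv hqv - ⟨s, hs, hss⟩ hp s' hs' hvs' hqs'
    simp only [insert_subset_iff, singleton_subset_iff] at hss
    exact hQ q (by simpa using hqv) s hs s' hs' hss.2.2 hvs' hss.2.1 hqs' (hp s hs hss.2.2 hss.1)
  · intro s hs hvs has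
    exact hQ a hav t ht s hs hvt hvs ha has h0

theorem t1_ge {B : Finset (Finset α)} {C : Finset α} (h : PM 3 B ∅) (hC : C ⊆ vs B)
    (hne : C.Nonempty) (hσ : ∃ σ ∈ B, Disjoint σ C) :
    3 ≤ (B.filter (fun t => (t ∩ C).card = 1)).card := by
  set T := B.filter (Tch C) with hT
  set D : Finset α → ℕ := fun e => (T.filter (fun t => e ⊆ t)).card with hD
  set b := (fc B 2).filter (fun e => Odd (D e)) with hb
  have ridge : ∀ e ∈ fc B 2, (B.filter (fun t => e ⊆ t)).card = 2 := by
    intro e he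
    rw [mem_fc] at he
    refine h.ridge2 e (by rw [he.2]) he.1 (fun hh => ?_)
    rw [subset_empty.1 hh] at he; simp at he
  have hsubT : ∀ e, T.filter (fun t => e ⊆ t) ⊆ B.filter (fun t => e ⊆ t) := by
    intro e t; simp only [hT, mem_filter]; tauto
  have hle : b.card ≤ (B.filter (fun t => (t ∩ C).card = 1)).card := by
    refine (card_le_card ?_).trans (card_image_le (f := fun t => t \ C))
    intro e he
    obtain ⟨he1, he2⟩ := mem_filter.1 he
    have hdis : Disjoint e C := by
      by_contra hcon
      have : T.filter (fun t => e ⊆ t) = B.filter (fun t => e ⊆ t) := by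
        apply (hsubT e).antisymm
        intro t ht
        obtain ⟨h1, h2⟩ := mem_filter.1 ht
        exact mem_filter.2 ⟨mem_filter.2 ⟨h1, Tch.mono hcon h2⟩, h2⟩
      simp only [hD, this, ridge e he1] at he2
      exact absurd he2 (by decide)
    obtain ⟨t, ht⟩ := card_pos.1 he2.pos
    obtain ⟨ht1, ht2⟩ := mem_filter.1 ht
    obtain ⟨ht3, ht4⟩ := mem_filter.1 ht1
    obtain ⟨v, hvt, hvC⟩ := tch_iff.1 ht4
    rw [mem_fc] at he1
    have hs : e ⊆ t \ C := fun x hx => mem_sdiff.2 ⟨ht2 hx, disjoint_left.1 hdis hx⟩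
    have e4 := card_inter_add_card_sdiff t C
    have e5 : 0 < (t ∩ C).card := card_pos.2 ⟨v, mem_inter.2 ⟨hvt, hvC⟩⟩
    rw [h.card t ht3] at e4
    have e6 := card_le_card hs
    rw [he1.2] at e6
    refine mem_image.2 ⟨t, mem_filter.2 ⟨ht3, by omega⟩, ?_⟩
    exact (eq_of_subset_of_card_le hs (by rw [he1.2]; omega)).symm
  refine le_trans ?_ hle
  have heven : ∀ x, ¬ Odd (b.filter (fun e => x ∈ e)).card := by
    intro x
    have e1 : b.filter (fun e => x ∈ e) =
        ((fc B 2).filter (fun e => x ∈ e)).filter (fun e => Odd (D e)) := by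
      ext e; simp only [hb, mem_filter]; tauto
    rw [e1, ← Finset.odd_sum_iff_odd_card_odd]
    have dc := sum_card_bipartiteAbove_eq_sum_card_bipartiteBelow
      (s := (fc B 2).filter (fun e => x ∈ e)) (t := T) (fun e t => e ⊆ t)
    simp only [bipartiteAbove, bipartiteBelow] at dc
    rw [show ∑ e ∈ (fc B 2).filter (fun e => x ∈ e), D e = _ from dc, Nat.not_odd_iff_even]
    refine Finset.even_sum _ fun t ht => ?_
    have htB := (mem_filter.1 ht).1
    by_cases hx : x ∈ t
    · have : ((fc B 2).filter (fun e => x ∈ e)).filter (fun e => e ⊆ t) =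
          (powersetCard 2 t).filter (fun e => x ∈ e) := by
        ext e; simp only [mem_filter, mem_fc, mem_powersetCard]
        constructor
        · rintro ⟨⟨⟨_, h2⟩, h3⟩, h4⟩; exact ⟨⟨h4, h2⟩, h3⟩
        · rintro ⟨⟨h4, h2⟩, h3⟩; exact ⟨⟨⟨⟨t, htB, h4⟩, h2⟩, h3⟩, h4⟩
      rw [this, card_edges_through (h.card t htB) hx]; decide
    · have : ((fc B 2).filter (fun e => x ∈ e)).filter (fun e => e ⊆ t) = ∅ := by
        ext e; simp only [mem_filter, notMem_empty, iff_false]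
        rintro ⟨⟨_, h3⟩, h4⟩; exact hx (h4 h3)
      rw [this]; simp
  have hbne : b.Nonempty := by
    by_contra hbe
    rw [not_nonempty_iff_eq_empty] at hbe
    have hcl : ∀ e ∈ fc B 2, ∀ t ∈ T, ∀ t' ∈ B, e ⊆ t → e ⊆ t' → t' ∈ T := by
      intro e he t ht t' ht' het het'
      have hnodd : ¬ Odd (D e) := fun ho => by
        have : e ∈ b := mem_filter.2 ⟨he, ho⟩
        rw [hbe] at this; simp at this
      have hpos : 0 < D e := card_pos.2 ⟨t, mem_filter.2 ⟨ht, het⟩⟩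
      have h2 : 2 ≤ D e := by
        by_contra hlt
        have : D e = 1 := by omega
        rw [this] at hnodd; exact hnodd (by decide)
      have := eq_of_subset_of_card_le (hsubT e) (by rw [ridge e he]; exact h2)
      have ht'' : t' ∈ T.filter (fun t => e ⊆ t) := by
        rw [this]; exact mem_filter.2 ⟨ht', het'⟩
      exact (mem_filter.1 ht'').1
    have hstar : ∀ v t t', t ∈ B → t' ∈ B → v ∈ t → v ∈ t' → t ∈ T → t' ∈ T := by
      intro v t t' ht ht' hvt hvt' htT
      refine star_conn h (by simp) (fun t => t ∈ T) ?_ ht ht' hvt hvt' htT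
      intro u hu t ht t' ht' h1 h2 h3 h4 hQ
      refine hcl {v, u} (mem_fc.2 ⟨⟨t, ht, ?_⟩, card_pair hu.symm⟩) t hQ t' ht' ?_ ?_ <;>
        simp [insert_subset_iff, *]
    obtain ⟨c, hc⟩ := hne
    obtain ⟨σ, hσ, hdis⟩ := hσ
    obtain ⟨w, hw⟩ := card_pos.1 (by rw [h.card σ hσ]; norm_num : 0 < σ.card)
    have := h.conn0 (by norm_num) {u | ∀ t ∈ B, u ∈ t → t ∈ T} ?_ (hC hc)
      (IsFc.mem_vs ⟨σ, hσ, Subset.rfl⟩ hw) (by simp) (by simp)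
      (fun t ht hct => mem_filter.2 ⟨ht, tch_iff.2 ⟨c, hct, hc⟩⟩)
    · exact (mem_filter.1 (this σ hσ hw)).2 hdis
    · rintro x y - - - ⟨t, ht, hts⟩ hx t' ht' hyt'
      simp only [insert_subset_iff, singleton_subset_iff] at hts
      exact hstar y t t' ht ht' hts.2 hyt' (hx t ht hts.1)
  obtain ⟨e, he⟩ := hbne
  have hc2 : ∀ e ∈ b, e.card = 2 := fun e he => (mem_fc.1 (mem_filter.1 he).1).2
  obtain ⟨x, y, hxy, rfl⟩ := card_eq_two.1 (hc2 e he)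
  have other : ∀ x, ∀ e ∈ b, x ∈ e → ∃ e' ∈ b, x ∈ e' ∧ e' ≠ e := by
    intro x e he hx
    have hm : e ∈ b.filter (fun e => x ∈ e) := mem_filter.2 ⟨he, hx⟩
    have : 1 < (b.filter (fun e => x ∈ e)).card := by
      by_contra hlt
      have hpos := card_pos.2 ⟨e, hm⟩
      have : (b.filter (fun e => x ∈ e)).card = 1 := by omega
      exact heven x (by rw [this]; decide)
    obtain ⟨e', he', hne'⟩ := exists_mem_ne this e
    exact ⟨e', (mem_filter.1 he').1, (mem_filter.1 he').2, hne'⟩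
  obtain ⟨f, hf, hxf, hfe⟩ := other x _ he (by simp)
  obtain ⟨g, hg, hyg, hge⟩ := other y _ he (by simp)
  have hfg : f ≠ g := by
    intro hfg
    apply hfe
    symm
    refine eq_of_subset_of_card_le ?_ (by rw [hc2 f hf, hc2 _ he])
    rw [insert_subset_iff, singleton_subset_iff]
    exact ⟨hxf, by rw [hfg]; exact hyg⟩
  have : ({{x, y}, f, g} : Finset (Finset α)) ⊆ b := by
    simp only [insert_subset_iff, singleton_subset_iff]; exact ⟨he, hf, hg⟩
  have hcard := card_le_card this
  rwa [card_eq_three.2 ⟨_, _, _, hfe.symm, hge.symm, hfg, rfl⟩] at hcard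

theorem A3 {B : Finset (Finset α)} (h : PM 3 B ∅) : ∀ (N : ℕ) (O : Finset α),
    (vs B \ O).card = N → (∃ σ ∈ B, σ ⊆ O) →
      3 * (vs B \ O).card ≤ ((fc B 2).filter (fun e => ¬ e ⊆ O)).card := by
  intro N
  induction N using Nat.strong_induction_on with
  | _ N ih =>
  intro O hN hO
  by_cases hsub : vs B ⊆ O
  · rw [sdiff_eq_empty_iff_subset.2 hsub]; simp
  have hne : (vs B \ O).Nonempty := by rwa [sdiff_nonempty]
  classical
  obtain ⟨C, hCm, hmin⟩ := exists_min_image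
    ((vs B \ O).powerset.filter (fun D => D.Nonempty ∧
      ∀ x ∈ D, ∀ y ∈ vs B \ O, IsFc B {x, y} → y ∈ D))
    card ⟨vs B \ O, by
      simp only [mem_filter, mem_powerset]
      exact ⟨Subset.rfl, hne, fun _ _ y hy _ => hy⟩⟩
  simp only [mem_filter, mem_powerset] at hCm hmin
  obtain ⟨hCs, hCne, hCcl⟩ := hCm
  have hCv : C ⊆ vs B := fun x hx => (mem_sdiff.1 (hCs hx)).1
  have hCO : ∀ x ∈ C, x ∉ O := fun x hx => (mem_sdiff.1 (hCs hx)).2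
  obtain ⟨σ, hσ, hσO⟩ := hO
  have hdis : Disjoint σ C := disjoint_left.2 fun x hx hxC => hCO x hxC (hσO hx)
  have hconn : ∀ S : Set α, (∀ x ∈ C, ∀ y ∈ C, x ≠ y → IsFc B {x, y} → x ∈ S → y ∈ S) →
      ∀ x ∈ C, ∀ y ∈ C, x ∈ S → y ∈ S := by
    intro S hS x hx y hy hxS
    have := hmin (C.filter (fun z => z ∈ S)) ⟨(filter_subset _ _).trans hCs,
      ⟨x, mem_filter.2 ⟨hx, hxS⟩⟩, fun a ha b hb hab => by
        obtain ⟨ha1, ha2⟩ := mem_filter.1 ha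
        have hbC := hCcl a ha1 b hb hab
        refine mem_filter.2 ⟨hbC, ?_⟩
        by_cases hab' : a = b
        · rw [← hab']; exact ha2
        · exact hS a ha1 b hbC hab' hab ha2⟩
    have := eq_of_subset_of_card_le (filter_subset _ _) this
    rw [← this] at hy
    exact (mem_filter.1 hy).2
  have hout : ∃ x ∈ C, ∃ y, y ∉ C ∧ IsFc B {x, y} := by
    by_contra hcon
    push Not at hcon
    obtain ⟨c, hc⟩ := hCne
    obtain ⟨w, hw⟩ := card_pos.1 (by rw [h.card σ hσ]; norm_num : 0 < σ.card)
    have := h.conn0 (by norm_num) {u | u ∈ C} (fun x y _ _ _ hxy hx => by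
      by_contra hy; exact hcon x hx y hy hxy) (hCv hc)
      (IsFc.mem_vs ⟨σ, hσ, Subset.rfl⟩ hw) (by simp) (by simp) hc
    exact disjoint_left.1 hdis hw this
  have h1 := lemma3 h (fun _ _ => by simp) hconn hout
  have h2 := t1_ge h hCv hCne ⟨σ, hσ, hdis⟩
  have hcard : (vs B \ O).card = (vs B \ (O ∪ C)).card + C.card := by
    rw [← card_union_of_disjoint]
    · congr 1; ext x
      have := @hCs x
      simp only [mem_sdiff, mem_union] at this ⊢
      tauto
    · rw [disjoint_left]; intro x
      simp only [mem_sdiff, mem_union]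
      tauto
  have hCpos := card_pos.2 hCne
  have h3 := ih _ (by omega) (O ∪ C) rfl ⟨σ, hσ, hσO.trans subset_union_left⟩
  have h4 : ((fc B 2).filter (fun e => ¬ e ⊆ O ∪ C)).card + ((fc B 2).filter (Tch C)).card ≤
      ((fc B 2).filter (fun e => ¬ e ⊆ O)).card := by
    rw [← card_union_of_disjoint]
    · apply card_le_card
      intro e he
      simp only [mem_union, mem_filter, tch_iff] at he ⊢
      rcases he with ⟨he1, he2⟩ | ⟨he1, v, he2, he3⟩
      · exact ⟨he1, fun hh => he2 (hh.trans subset_union_left)⟩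
      · exact ⟨he1, fun hh => hCO v he3 (hh he2)⟩
    · rw [disjoint_left]
      intro e he he'
      simp only [mem_filter, tch_iff] at he he'
      apply he.2
      obtain ⟨he1, v, hv, hvC⟩ := he'
      intro y hy
      by_cases hyO : y ∈ O
      · exact mem_union_left _ hyO
      · refine mem_union_right _ (hCcl v hvC y (mem_sdiff.2 ⟨(mem_fc.1 he1).1.mem_vs hy, hyO⟩)
          ((mem_fc.1 he1).1.mono ?_))
        simp [insert_subset_iff, hv, hy]
  omega

theorem Ae (d : ℕ) (hd : 3 ≤ d) : ∀ (B : Finset (Finset α)), PM d B ∅ → ∀ O : Finset α,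
    (∃ σ ∈ B, σ ⊆ O) → d * (vs B \ O).card ≤ ((fc B 2).filter (fun e => ¬ e ⊆ O)).card := by
  induction d, hd using Nat.le_induction with
  | base => intro B h O hO; exact A3 h _ O rfl hO
  | succ d hd ih =>
    intro B h O hO
    have := grow (by omega) ih B ∅ h _ O rfl hO
    rw [union_empty, inter_empty, empty_sdiff, card_empty, add_zero] at this
    refine this.trans (card_le_card ?_)
    intro e he
    simp only [mem_filter] at he ⊢
    exact ⟨he.1, he.2.2⟩

theorem closed_f1 {d : ℕ} (hd : 3 ≤ d) {B : Finset (Finset α)} (h : PM d B ∅) :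
    d * (vs B).card + d.choose 2 ≤ (fc B 2).card + d * d := by
  obtain ⟨σ, hσ⟩ := h.ne
  have h1 := Ae d hd B h σ ⟨σ, hσ, Subset.rfl⟩
  have hσv : σ ⊆ vs B := fun x hx => IsFc.mem_vs ⟨σ, hσ, Subset.rfl⟩ hx
  have h2 : (fc B 2).filter (fun e => e ⊆ σ) = powersetCard 2 σ := by
    ext e; simp only [mem_filter, mem_fc, mem_powersetCard]
    exact ⟨fun hh => ⟨hh.2, hh.1.2⟩, fun hh => ⟨⟨⟨σ, hσ, hh.1⟩, hh.2⟩, hh.1⟩⟩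
  have h3 := card_filter_add_card_filter_not (s := fc B 2) (fun e => e ⊆ σ)
  rw [h2, card_powersetCard, h.card σ hσ] at h3
  have h4 := card_sdiff_add_card_eq_card hσv
  rw [h.card σ hσ] at h4
  rw [← h4, Nat.mul_add]
  omega

end comb3

section comb4
variable {α : Type*} [DecidableEq α]

/-- Boundary ridges. -/
def bd (d : ℕ) (B : Finset (Finset α)) (W : Finset α) : Finset (Finset α) :=
  (fc B d).filter (fun ρ => ρ ⊆ W)

/-- Normal pseudomanifold with boundary whose facets have `d + 1` vertices. -/
structure Rel (d : ℕ) (B : Finset (Finset α)) (W : Finset α) : Prop where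
  pm : PM (d + 1) B W
  ridge1 : ∀ ρ, ρ.card = d → IsFc B ρ → ρ ⊆ W → (B.filter (fun σ => ρ ⊆ σ)).card = 1
  ext : ∀ τ, IsFc B τ → τ ⊆ W → ∃ ρ, τ ⊆ ρ ∧ ρ.card = d ∧ IsFc B ρ ∧ ρ ⊆ W
  bdPM : PM d (bd d B W) ∅

variable {d : ℕ} {B : Finset (Finset α)} {W : Finset α}

theorem Rel.isFc_bd (h : Rel d B W) {τ : Finset α} : IsFc (bd d B W) τ ↔ IsFc B τ ∧ τ ⊆ W := by
  constructor
  · rintro ⟨ρ, h1, h2⟩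
    simp only [bd, mem_filter, mem_fc] at h1
    exact ⟨h1.1.1.mono h2, h2.trans h1.2⟩
  · rintro ⟨h1, h2⟩
    obtain ⟨ρ, h3, h4, h5, h6⟩ := h.ext τ h1 h2
    exact ⟨ρ, mem_filter.2 ⟨mem_fc.2 ⟨h5, h4⟩, h6⟩, h3⟩

theorem Rel.fc_bd (h : Rel d B W) (k : ℕ) : fc (bd d B W) k = (fc B k).filter (fun ρ => ρ ⊆ W) := by
  ext τ
  simp only [mem_fc, h.isFc_bd, mem_filter]; tauto

theorem Rel.vs_bd (h : Rel d B W) : vs (bd d B W) = vs B ∩ W := by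
  ext v
  rw [mem_vs, h.isFc_bd, mem_inter, mem_vs, singleton_subset_iff]

theorem bd_lk {v : α} (hv : v ∈ W) : bd d (lk B v) W = lk (bd (d + 1) B W) v := by
  ext ρ
  simp only [bd, mem_filter, mem_fc, mem_lk, isFc_lk]
  constructor
  · rintro ⟨⟨⟨h1, h2⟩, h3⟩, h4⟩
    exact ⟨h1, ⟨h2, by rw [card_insert_of_notMem h1, h3]⟩, insert_subset hv h4⟩
  · rintro ⟨h1, ⟨h2, h3⟩, h4⟩
    rw [card_insert_of_notMem h1] at h3
    exact ⟨⟨⟨h1, h2⟩, by omega⟩, (subset_insert _ _).trans h4⟩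

theorem Rel.link (h : Rel (d + 1) B W) (hd : 1 ≤ d) {v : α} (hv : v ∈ vs B) (hW : v ∈ W) :
    Rel d (lk B v) W where
  pm := h.pm.link_in hv hW
  ridge1 := fun ρ h1 h2 h3 => by
    rw [isFc_lk] at h2
    rw [card_lk_filter h2.1]
    exact h.ridge1 _ (by rw [card_insert_of_notMem h2.1, h1]) h2.2 (insert_subset hW h3)
  ext := fun τ h1 h2 => by
    rw [isFc_lk] at h1
    obtain ⟨ρ, h3, h4, h5, h6⟩ := h.ext _ h1.2 (insert_subset hW h2)
    have hvρ : v ∈ ρ := h3 (by simp)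
    refine ⟨ρ.erase v, ?_, ?_, ?_, (erase_subset _ _).trans h6⟩
    · intro x hx
      exact mem_erase.2 ⟨fun hh => h1.1 (hh ▸ hx), h3 (by simp [hx])⟩
    · rw [card_erase_of_mem hvρ, h4]; rfl
    · exact isFc_lk.2 ⟨by simp, by rwa [insert_erase hvρ]⟩
  bdPM := by
    rw [bd_lk hW]
    exact h.bdPM.link_out (by rw [h.vs_bd]; exact mem_inter.2 ⟨hv, hW⟩) (by simp) hd

theorem closed2 {B : Finset (Finset α)} (h : PM 2 B ∅) : B.card = (vs B).card := by
  have h1 := sum_fc_lk B 1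
  rw [show 1 + 1 = 2 from rfl, fc_top h.card] at h1
  have h2 : ∑ v ∈ vs B, (fc (lk B v) 1).card = ∑ v ∈ vs B, 2 := by
    refine sum_congr rfl fun v hv => ?_
    rw [card_fc_lk, fc_top h.card, ← h.ridge2 {v} (by simp) (mem_vs.1 hv) (by simp)]
    simp only [singleton_subset_iff]
  rw [h2, sum_const, smul_eq_mul] at h1
  omega

/-- edges not in `W` -/
theorem Rel.edges (h : Rel d B W) (hd : 2 ≤ d) :
    (d + 1) * (vs B \ W).card + (vs B ∩ W).card ≤
      ((fc B 2).filter (fun e => ¬ e ⊆ W)).card + (d + 1) := by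
  obtain ⟨ρ, hρ⟩ := h.bdPM.ne
  have hρ' := hρ
  simp only [bd, mem_filter, mem_fc] at hρ
  obtain ⟨⟨⟨σ, hσ, hρσ⟩, hρc⟩, hρW⟩ := hρ
  have hσv : σ ⊆ vs B := fun x hx => IsFc.mem_vs ⟨σ, hσ, Subset.rfl⟩ hx
  obtain ⟨w, hwσ, hwW⟩ := not_subset.1 (h.pm.nW σ hσ)
  have hwρ : w ∉ ρ := fun hh => hwW (hρW hh)
  have hσe : σ = insert w ρ := by
    symm
    apply eq_of_subset_of_card_le (insert_subset hwσ hρσ)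
    rw [card_insert_of_notMem hwρ, hρc, h.pm.card σ hσ]
  rcases Nat.lt_or_ge 2 d with hd3 | hd2
  · have g := grow (by omega) (Ae d hd3) B W h.pm _ σ rfl ⟨σ, hσ, Subset.rfl⟩
    have c1 : (vs B \ W).card = (vs B \ (σ ∪ W)).card + 1 := by
      rw [← card_singleton w, ← card_union_of_disjoint]
      · congr 1; ext x
        simp only [mem_sdiff, mem_union, mem_singleton, hσe, mem_insert]
        have := @hρW x
        have h1 : x = w → x ∈ vs B ∧ x ∉ W := by rintro rfl; exact ⟨hσv hwσ, hwW⟩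
        tauto
      · rw [disjoint_singleton_right]; simp [hwσ]
    have c2 : (vs B ∩ W).card = ((vs B ∩ W) \ σ).card + d := by
      rw [← hρc, ← card_union_of_disjoint]
      · congr 1; ext x
        simp only [mem_sdiff, mem_union, hσe, mem_insert, mem_inter]
        have h0 := @hρW x
        have h1 : x = w → x ∉ W := by rintro rfl; exact hwW
        have h2 : x ∈ ρ → x ∈ vs B := fun hx => hσv (hρσ hx)
        tauto
      · rw [disjoint_right]; intro x hx hh
        exact (mem_sdiff.1 hh).2 (hρσ hx)
    have c3 : ((fc B 2).filter (fun e => ¬ e ⊆ W ∧ ¬ e ⊆ σ)).card + d ≤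
        ((fc B 2).filter (fun e => ¬ e ⊆ W)).card := by
      have : (ρ.image (fun u => ({w, u} : Finset α))).card = d := by
        rw [card_image_of_injOn, hρc]
        intro a ha b hb hab
        have hab' : ({w, a} : Finset α) = {w, b} := hab
        have : a ∈ ({w, b} : Finset α) := by rw [← hab']; simp
        simp only [mem_insert, mem_singleton] at this
        rcases this with rfl | h
        · exact absurd ha hwρ
        · exact h
      rw [← this, ← card_union_of_disjoint]
      · apply card_le_card
        intro e he
        rcases mem_union.1 he with he | he
        · simp only [mem_filter] at he ⊢; exact ⟨he.1, he.2.1⟩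
        · obtain ⟨u, hu, rfl⟩ := mem_image.1 he
          refine mem_filter.2 ⟨mem_fc.2 ⟨⟨σ, hσ, ?_⟩, card_pair ?_⟩, fun hh => hwW (hh (by simp))⟩
          · simp [insert_subset_iff, hwσ, hρσ hu]
          · rintro rfl; exact hwρ hu
      · rw [disjoint_left]
        intro e he he'
        obtain ⟨u, hu, rfl⟩ := mem_image.1 he'
        refine (mem_filter.1 he).2.2 ?_
        simp [insert_subset_iff, hwσ, hρσ hu]
    rw [c1, c2, Nat.mul_add]
    omega
  · obtain rfl : d = 2 := by omega
    have hm : (bd 2 B W).card = (vs B ∩ W).card := by rw [closed2 h.bdPM, h.vs_bd]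
    have l3 := lemma3 (C := vs B \ W) h.pm (fun v hv => (mem_sdiff.1 hv).2) ?_ ?_
    · have e1 : (fc B 2).filter (Tch (vs B \ W)) = (fc B 2).filter (fun e => ¬ e ⊆ W) := by
        refine filter_congr fun e he => ?_
        rw [tch_iff, not_subset]
        constructor
        · rintro ⟨v, h1, h2⟩; exact ⟨v, h1, (mem_sdiff.1 h2).2⟩
        · rintro ⟨v, h1, h2⟩; exact ⟨v, h1, mem_sdiff.2 ⟨(mem_fc.1 he).1.mem_vs h1, h2⟩⟩
      rw [e1] at l3
      have e2 : (bd 2 B W).card ≤ (B.filter (fun t => (t ∩ (vs B \ W)).card = 1)).card := by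
        refine (card_le_card ?_).trans (card_image_le (f := fun t => t \ (vs B \ W)))
        intro e he
        simp only [bd, mem_filter, mem_fc] at he
        obtain ⟨⟨⟨t, ht, het⟩, hec⟩, heW⟩ := he
        have hs : e ⊆ t \ (vs B \ W) := fun x hx =>
          mem_sdiff.2 ⟨het hx, fun hh => (mem_sdiff.1 hh).2 (heW hx)⟩
        have e4 := card_inter_add_card_sdiff t (vs B \ W)
        obtain ⟨v, hvt, hvW⟩ := not_subset.1 (h.pm.nW t ht)
        have e5 : 0 < (t ∩ (vs B \ W)).card := card_pos.2 ⟨v, mem_inter.2 ⟨hvt,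
          mem_sdiff.2 ⟨IsFc.mem_vs ⟨t, ht, Subset.rfl⟩ hvt, hvW⟩⟩⟩
        rw [h.pm.card t ht] at e4
        have e6 := card_le_card hs
        rw [hec] at e6
        refine mem_image.2 ⟨t, mem_filter.2 ⟨ht, by omega⟩, ?_⟩
        exact (eq_of_subset_of_card_le hs (by rw [hec]; omega)).symm
      omega
    · intro S hS x hx y hy hxS
      rw [mem_sdiff] at hx hy
      refine (h.pm.conn0 (by norm_num) {z | z ∈ S} ?_ hx.1 hy.1 hx.2 hy.2 hxS)
      intro a b hab ha hb hf haS
      exact hS a (mem_sdiff.2 ⟨hf.mem_vs (by simp), ha⟩) b (mem_sdiff.2 ⟨hf.mem_vs (by simp), hb⟩)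
        hab hf haS
    · obtain ⟨u, hu⟩ := card_pos.1 (by rw [hρc]; norm_num : 0 < ρ.card)
      refine ⟨w, mem_sdiff.2 ⟨hσv hwσ, hwW⟩, u, fun hh => (mem_sdiff.1 hh).2 (hρW hu), σ, hσ, ?_⟩
      simp [insert_subset_iff, hwσ, hρσ hu]

theorem closed_top (k : ℕ) : ∀ (B : Finset (Finset α)), PM (k + 2) B ∅ →
    (k + 1) * (vs B).card + 2 ≤ B.card + (k + 1) * (k + 2) := by
  induction k with
  | zero => intro B h; rw [closed2 h]; omega
  | succ k ih =>
    intro B h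
    have hs : ∑ v ∈ vs B, ((k + 1) * (vs (lk B v)).card + 2) ≤
        ∑ v ∈ vs B, ((fc (lk B v) (k + 2)).card + (k + 1) * (k + 2)) := by
      refine sum_le_sum fun v hv => ?_
      have hl := h.link_out hv (by simp) (by omega)
      rw [fc_top hl.card]
      exact ih _ hl
    rw [sum_add_distrib, sum_add_distrib, ← mul_sum, sum_deg, sum_fc_lk, fc_top h.card, sum_const,
      sum_const, smul_eq_mul, smul_eq_mul] at hs
    have f1 := closed_f1 (by omega) h
    have hc : (k + 1 + 2).choose 2 * 2 = (k + 3) * (k + 2) := by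
      rw [Nat.choose_two_right]
      exact Nat.div_mul_cancel (Nat.even_mul_pred_self (k + 3)).two_dvd
    generalize (k + 1 + 2).choose 2 = c at *
    generalize (fc B 2).card = f at *
    generalize (vs B).card = n at *
    generalize B.card = b at *
    have : (k + 3) * ((k + 1 + 1) * n + 2) ≤ (k + 3) * (b + (k + 1 + 1) * (k + 1 + 2)) := by
      nlinarith [Nat.mul_le_mul_left (2 * (k + 1)) f1]
    exact Nat.le_of_mul_le_mul_left this (by omega)

theorem Rel.ridges (h : Rel d B W) :
    2 * (fc B d).card = (d + 1) * B.card + (bd d B W).card := by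
  have dc := sum_card_bipartiteAbove_eq_sum_card_bipartiteBelow (s := fc B d) (t := B)
    (fun e t => e ⊆ t)
  simp only [bipartiteAbove, bipartiteBelow] at dc
  have e1 : ∑ σ ∈ B, ((fc B d).filter (fun e => e ⊆ σ)).card = (d + 1) * B.card := by
    rw [mul_comm, ← smul_eq_mul, ← sum_const]
    refine sum_congr rfl fun σ hσ => ?_
    have : (fc B d).filter (fun e => e ⊆ σ) = powersetCard d σ := by
      ext e; simp only [mem_filter, mem_fc, mem_powersetCard]
      exact ⟨fun hh => ⟨hh.2, hh.1.2⟩, fun hh => ⟨⟨⟨σ, hσ, hh.1⟩, hh.2⟩, hh.1⟩⟩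
    rw [this, card_powersetCard, h.pm.card σ hσ, Nat.choose_succ_self_right]
  rw [← e1, ← dc, bd, card_filter, ← sum_add_distrib, mul_comm, ← smul_eq_mul, ← sum_const]
  refine sum_congr rfl fun ρ hρ => ?_
  rw [mem_fc] at hρ
  by_cases hW : ρ ⊆ W
  · rw [h.ridge1 ρ hρ.2 hρ.1 hW, if_pos hW]
  · rw [h.pm.ridge2 ρ (by rw [hρ.2]) hρ.1 hW, if_neg hW]

theorem Rel.f1_eq (h : Rel d B W) :
    (fc B 2).card = ((fc B 2).filter (fun e => ¬ e ⊆ W)).card + (fc (bd d B W) 2).card := by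
  rw [h.fc_bd, add_comm, card_filter_add_card_filter_not]

theorem vs_split (B : Finset (Finset α)) (W : Finset α) :
    (vs B).card = (vs B \ W).card + (vs B ∩ W).card := by
  rw [add_comm, card_inter_add_card_sdiff]

theorem Rel.top (k : ℕ) : ∀ (B : Finset (Finset α)) (W : Finset α), Rel (k + 2) B W →
    (k + 2) * (vs B).card + (k + 4) ≤ B.card + (vs B ∩ W).card + (k + 2) * (k + 3) := by
  induction k with
  | zero =>
    intro B W h
    have h1 := h.ridges
    have h2 := h.edges le_rfl
    have h3 := h.f1_eq
    have h4 := closed2 h.bdPM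
    rw [fc_top h.bdPM.card] at h3
    rw [h.vs_bd] at h4
    have h5 := vs_split B W
    simp only [Nat.zero_add] at *
    omega
  | succ k ih =>
    intro B W h
    have hs : ∀ v ∈ vs B, (k + 2) * (vs (lk B v)).card + 2 + (if v ∈ W then (k + 2) else 0) ≤
        (fc (lk B v) (k + 3)).card + (k + 2) * (k + 3) +
          (if v ∈ W then (vs (lk (bd (k + 3) B W) v)).card else 0) := by
      intro v hv
      split_ifs with hW
      · have hl := h.link (by omega) hv hW
        rw [fc_top hl.pm.card, ← bd_lk hW, hl.vs_bd]
        have := ih _ _ hl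
        omega
      · have hl := h.pm.link_out hv hW (by omega)
        rw [fc_top hl.card]
        exact closed_top (k + 1) _ hl
    have hs := sum_le_sum hs
    simp only [sum_add_distrib] at hs
    rw [← sum_filter, ← sum_filter, filter_mem_eq_inter, ← mul_sum, sum_deg, sum_fc_lk,
      fc_top h.pm.card, sum_const, ← h.vs_bd, sum_deg, sum_const,
      sum_const, smul_eq_mul, smul_eq_mul, smul_eq_mul, h.vs_bd] at hs
    have he := h.edges (by omega)
    have hf := h.f1_eq
    have hb := closed_f1 (by omega) h.bdPM
    rw [h.vs_bd] at hb
    have hv := vs_split B W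
    have hc : (k + 1 + 2).choose 2 * 2 = (k + 3) * (k + 2) := by
      rw [Nat.choose_two_right]
      exact Nat.div_mul_cancel (Nat.even_mul_pred_self (k + 3)).two_dvd
    change _ ≤ _ at hs
    rw [hf] at hs
    rw [hv] at hs ⊢
    generalize (k + 1 + 2).choose 2 = c at *
    change (k + 1 + 2) * _ + _ ≤ (fc (bd (k + 3) B W) 2).card + _ at hb
    generalize (fc (bd (k + 3) B W) 2).card = fb at *
    generalize ((fc B 2).filter (fun e => ¬ e ⊆ W)).card = f at *
    generalize (vs B ∩ W).card = m at *
    generalize (vs B \ W).card = n at *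
    generalize B.card = b at *
    have : (k + 4) * ((k + 1 + 2) * (n + m) + (k + 1 + 4)) ≤
        (k + 4) * (b + m + (k + 1 + 2) * (k + 1 + 3)) := by
      nlinarith [Nat.mul_le_mul_left (2 * (k + 1)) hb, Nat.mul_le_mul_left (2 * (k + 2)) he]
    exact Nat.le_of_mul_le_mul_left this (by omega)

theorem step_arith {D i n f g : ℕ} (h1 : (D + 1) * n ≤ f + (D + 2).choose 2)
    (h2 : D.choose i * (2 * f) ≤ (i + 2) * g + n * ((D + 1).choose (i + 1) * i)) :
    (D + 1).choose (i + 1) * n ≤ g + (D + 2).choose (i + 2) * (i + 1) := by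
  have e1 := Nat.add_one_mul_choose_eq D i
  have e2 := Nat.add_one_mul_choose_eq (D + 1) (i + 1)
  have e3 : (D + 2).choose 2 * 2 = (D + 2) * (D + 1) := by
    rw [Nat.choose_two_right]
    exact Nat.div_mul_cancel (Nat.even_mul_pred_self (D + 2)).two_dvd
  simp only [Nat.add_assoc, Nat.reduceAdd] at e1 e2
  generalize (D + 2).choose 2 = c at *
  generalize (D + 2).choose (i + 2) = z at *
  generalize (D + 1).choose (i + 1) = y at *
  generalize D.choose i = x at *
  have h3 : (i + 2) * (y * n) ≤ (i + 2) * (g + z * (i + 1)) := by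
    have h4 := Nat.mul_le_mul_left (2 * x) h1
    have e4 : 2 * x * ((D + 1) * n) = 2 * n * (y * (i + 1)) := by rw [← e1]; ring
    have e5 : 2 * x * c = (i + 2) * (z * (i + 1)) := by
      calc 2 * x * c = x * (c * 2) := by ring
        _ = (D + 2) * ((D + 1) * x) := by rw [e3]; ring
        _ = (i + 1) * ((D + 2) * y) := by rw [e1]; ring
        _ = _ := by rw [e2]; ring
    rw [e4, Nat.mul_add (2 * x), e5] at h4
    nlinarith
  exact Nat.le_of_mul_le_mul_left h3 (by omega)

theorem closed_f1' {D : ℕ} (hd : 2 ≤ D) {B : Finset (Finset α)} (h : PM (D + 1) B ∅) :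
    (D + 1) * (vs B).card ≤ (fc B 2).card + (D + 2).choose 2 := by
  have h1 := closed_f1 (by omega) h
  have e3 : (D + 2).choose 2 * 2 = (D + 2) * (D + 1) := by
    rw [Nat.choose_two_right]
    exact Nat.div_mul_cancel (Nat.even_mul_pred_self (D + 2)).two_dvd
  have e4 : (D + 1).choose 2 * 2 = (D + 1) * D := by
    rw [Nat.choose_two_right]
    exact Nat.div_mul_cancel (Nat.even_mul_pred_self (D + 1)).two_dvd
  nlinarith

theorem closed_fi (i : ℕ) : ∀ (D : ℕ) (B : Finset (Finset α)), PM (D + 1) B ∅ → i + 2 ≤ D →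
    (D + 1).choose (i + 1) * (vs B).card ≤
      (fc B (i + 2)).card + (D + 2).choose (i + 2) * (i + 1) := by
  induction i with
  | zero =>
    intro D B h hD
    have := closed_f1' (by omega) h
    simpa using this
  | succ i ih =>
    intro D B h hD
    obtain ⟨D, rfl⟩ : ∃ D', D = D' + 1 := ⟨D - 1, by omega⟩
    have hs : ∀ v ∈ vs B, (D + 1).choose (i + 1) * (vs (lk B v)).card ≤
        (fc (lk B v) (i + 2)).card + (D + 2).choose (i + 2) * (i + 1) := fun v hv =>
      ih D _ (h.link_out hv (by simp) (by omega)) (by omega)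
    have hs := sum_le_sum hs
    rw [sum_add_distrib, ← mul_sum, sum_deg, sum_fc_lk, sum_const, smul_eq_mul] at hs
    exact step_arith (closed_f1' (by omega) h) hs

theorem Rel.f1 (h : Rel d B W) (hd : 3 ≤ d) :
    (d + 1) * (vs B).card ≤ (fc B 2).card + (d + 2).choose 2 := by
  have h1 := closed_f1 hd h.bdPM
  have h2 := h.edges (by omega)
  rw [h.f1_eq, vs_split B W]
  rw [h.vs_bd] at h1
  have e3 : (d + 2).choose 2 * 2 = (d + 2) * (d + 1) := by
    rw [Nat.choose_two_right]
    exact Nat.div_mul_cancel (Nat.even_mul_pred_self (d + 2)).two_dvd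
  have e4 : d.choose 2 * 2 = d * (d - 1) := by
    rw [Nat.choose_two_right]
    exact Nat.div_mul_cancel (Nat.even_mul_pred_self d).two_dvd
  obtain ⟨d, rfl⟩ : ∃ e, d = e + 1 := ⟨d - 1, by omega⟩
  rw [Nat.add_sub_cancel] at e4
  nlinarith

theorem Rel.fi (i : ℕ) : ∀ (D : ℕ) (B : Finset (Finset α)) (W : Finset α), Rel D B W → i + 3 ≤ D →
    (D + 1).choose (i + 1) * (vs B).card ≤
      (fc B (i + 2)).card + (D + 2).choose (i + 2) * (i + 1) := by
  induction i with
  | zero =>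
    intro D B W h hD
    have := h.f1 (by omega)
    simpa using this
  | succ i ih =>
    intro D B W h hD
    obtain ⟨D, rfl⟩ : ∃ D', D = D' + 1 := ⟨D - 1, by omega⟩
    have hs : ∀ v ∈ vs B, (D + 1).choose (i + 1) * (vs (lk B v)).card ≤
        (fc (lk B v) (i + 2)).card + (D + 2).choose (i + 2) * (i + 1) := fun v hv => by
      by_cases hW : v ∈ W
      · exact ih D _ _ (h.link (by omega) hv hW) (by omega)
      · exact closed_fi i D _ (h.pm.link_out hv hW (by omega)) (by omega)
    have hs := sum_le_sum hs
    rw [sum_add_distrib, ← mul_sum, sum_deg, sum_fc_lk, sum_const, smul_eq_mul] at hs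
    exact step_arith (h.f1 (by omega)) hs

theorem Rel.ridge_bound {k : ℕ} (h : Rel (k + 2) B W) :
    (k + 3) * ((k + 2) * (vs B).card + (k + 4)) + (k + 1) * (vs B ∩ W).card + 2 ≤
      2 * (fc B (k + 2)).card + (k + 3) * ((vs B ∩ W).card + (k + 2) * (k + 3))
        + (k + 1) * (k + 2) := by
  have h1 := h.ridges
  have h2 := Rel.top k B W h
  have h3 := closed_top k _ h.bdPM
  rw [h.vs_bd] at h3
  have h4 := Nat.mul_le_mul_left (k + 3) h2
  have e : (k + 2 + 1) * B.card = (k + 3) * B.card := by ring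
  rw [e] at h1
  nlinarith
end comb4

section geo1
variable {α : Type*} [DecidableEq α]
open scoped Classical in
/-- zero set -/
def zs (X : Finset α) (f : α → ℝ) : Finset α := X.filter (fun x => f x = 0)

/-- nonnegative on `X` -/
def NN (X : Finset α) (f : α → ℝ) : Prop := ∀ x ∈ X, 0 ≤ f x

theorem mem_zs {X : Finset α} {f : α → ℝ} {x : α} : x ∈ zs X f ↔ x ∈ X ∧ f x = 0 := by
  simp [zs]

/-- facets -/
def Fct (A : Submodule ℝ (α → ℝ)) (X σ : Finset α) : Prop :=
  ∃ f ∈ A, NN X f ∧ (∃ x ∈ X, f x ≠ 0) ∧ zs X f = σ ∧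
    ∀ g ∈ A, (∀ x ∈ σ, g x = 0) → ∃ c : ℝ, ∀ x ∈ X, g x = c * f x

variable {A : Submodule ℝ (α → ℝ)} {X : Finset α}

theorem NN.pos {f : α → ℝ} (h : NN X f) {x : α} (hx : x ∈ X) (hn : x ∉ zs X f) : 0 < f x :=
  lt_of_le_of_ne (h x hx) fun hh => hn (mem_zs.2 ⟨hx, hh.symm⟩)

theorem perturb {f g : α → ℝ} (hf : NN X f) (hg : ∀ x ∈ zs X f, 0 ≤ g x) :
    ∃ M : ℝ, NN X (M • f + g) ∧ ∀ x, x ∈ zs X (M • f + g) ↔ x ∈ zs X f ∧ g x = 0 := by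
  set M : ℝ := 1 + ∑ x ∈ X, |g x| / f x with hM
  have key : ∀ x ∈ X, x ∉ zs X f → 0 < M * f x + g x := by
    intro x hx hn
    have hp := hf.pos hx hn
    have h1 : |g x| / f x ≤ ∑ x ∈ X, |g x| / f x :=
      single_le_sum (f := fun x => |g x| / f x) (fun y hy => div_nonneg (abs_nonneg _) (hf y hy)) hx
    have h2 : |g x| / f x * f x = |g x| := by field_simp
    have h3 := neg_abs_le (g x)
    nlinarith
  refine ⟨M, ?_, ?_⟩
  · intro x hx
    simp only [Pi.add_apply, Pi.smul_apply, smul_eq_mul]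
    by_cases hn : x ∈ zs X f
    · rw [(mem_zs.1 hn).2]; simpa using hg x hn
    · exact (key x hx hn).le
  · intro x
    rw [mem_zs]
    simp only [Pi.add_apply, Pi.smul_apply, smul_eq_mul]
    constructor
    · rintro ⟨h1, h2⟩
      by_cases hn : x ∈ zs X f
      · refine ⟨hn, ?_⟩
        rw [(mem_zs.1 hn).2] at h2; simpa using h2
      · exact absurd h2 (key x h1 hn).ne'
    · rintro ⟨h1, h2⟩
      rw [mem_zs] at h1
      exact ⟨h1.1, by rw [h1.2, h2]; simp⟩

theorem rot {p : α → ℝ} (h : α → ℝ) (hp : ∃ x ∈ X, 0 < p x) :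
    ∃ t : ℝ, ∃ x0 ∈ X, 0 < p x0 ∧ h x0 = t * p x0 ∧ ∀ x ∈ X, 0 < p x → t * p x ≤ h x := by
  classical
  obtain ⟨a, ha, hpa⟩ := hp
  obtain ⟨x0, hx0, hmin⟩ := exists_min_image (X.filter (fun x => 0 < p x)) (fun x => h x / p x)
    ⟨a, mem_filter.2 ⟨ha, hpa⟩⟩
  obtain ⟨h1, h2⟩ := mem_filter.1 hx0
  refine ⟨h x0 / p x0, x0, h1, h2, by field_simp, fun x hx hpx => ?_⟩
  have := hmin x (mem_filter.2 ⟨hx, hpx⟩)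
  rwa [← le_div_iff₀ hpx]

theorem exists_pos {f : α → ℝ} (h : NN X f) (h0 : ∃ x ∈ X, f x ≠ 0) : ∃ x ∈ X, 0 < f x := by
  obtain ⟨x, hx, hn⟩ := h0
  exact ⟨x, hx, lt_of_le_of_ne (h x hx) hn.symm⟩

theorem exists_fct : ∀ (N : ℕ) (f : α → ℝ), (X \ zs X f).card = N → f ∈ A → NN X f →
    (∃ x ∈ X, f x ≠ 0) → ∃ σ, Fct A X σ ∧ zs X f ⊆ σ := by
  intro N
  induction N using Nat.strong_induction_on with
  | _ N ih =>
  intro f hN hfA hf h0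
  by_cases hfct : ∀ g ∈ A, (∀ x ∈ zs X f, g x = 0) → ∃ c : ℝ, ∀ x ∈ X, g x = c * f x
  · exact ⟨_, ⟨f, hfA, hf, h0, rfl, hfct⟩, Subset.rfl⟩
  push Not at hfct
  obtain ⟨g, hgA, hg0, hgc⟩ := hfct
  obtain ⟨t, x0, hx0, hp0, heq, hle⟩ := rot g (exists_pos hf h0)
  have hk : NN X (g - t • f) := by
    intro x hx
    simp only [Pi.sub_apply, Pi.smul_apply, smul_eq_mul]
    by_cases hn : x ∈ zs X f
    · rw [hg0 x hn, (mem_zs.1 hn).2]; simp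
    · linarith [hle x hx (hf.pos hx hn)]
  have hsub : zs X f ⊆ zs X (g - t • f) := by
    intro x hx
    refine mem_zs.2 ⟨(mem_zs.1 hx).1, ?_⟩
    simp [hg0 x hx, (mem_zs.1 hx).2]
  have hlt : (X \ zs X (g - t • f)).card < N := by
    rw [← hN]
    apply card_lt_card
    refine ⟨sdiff_subset_sdiff Subset.rfl hsub, fun hh => ?_⟩
    have h1 : x0 ∈ X \ zs X f := mem_sdiff.2 ⟨hx0, fun hz => hp0.ne' (mem_zs.1 hz).2⟩
    have h2 := (mem_sdiff.1 (hh h1)).2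
    apply h2
    refine mem_zs.2 ⟨hx0, ?_⟩
    simp [heq]
  obtain ⟨x1, hx1, hne⟩ := hgc t
  obtain ⟨σ, h1, h2⟩ := ih _ hlt (g - t • f) rfl (A.sub_mem hgA (A.smul_mem _ hfA)) hk
    ⟨x1, hx1, by simpa [sub_eq_zero] using hne⟩
  exact ⟨σ, h1, hsub.trans h2⟩

theorem Fct.sub {σ : Finset α} (h : Fct A X σ) : σ ⊆ X := by
  obtain ⟨f, _, _, _, rfl, _⟩ := h
  exact fun x hx => (mem_zs.1 hx).1

/-- values on `σ` can be prescribed -/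
def Pre (A : Submodule ℝ (α → ℝ)) (σ : Finset α) : Prop :=
  ∀ c : α → ℝ, ∃ g ∈ A, ∀ x ∈ σ, g x = c x

theorem ridge_lemma {σ : Finset α} (h : Fct A X σ) (hp : Pre A σ) {v : α} (hv : v ∈ σ) :
    ∃ σ2, σ2 ≠ σ ∧ Fct A X σ2 ∧ σ.erase v ⊆ σ2 ∧
      ∀ τ, Fct A X τ → σ.erase v ⊆ τ → τ = σ ∨ τ = σ2 := by
  obtain ⟨f, hfA, hf, h0, hz, hfct⟩ := h
  obtain ⟨g, hgA, hg⟩ := hp (fun x => if x = v then 1 else 0)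
  obtain ⟨t, x0, hx0, hp0, heq, hle⟩ := rot g (exists_pos hf h0)
  have hvX : v ∈ X := by rw [← hz] at hv; exact (mem_zs.1 hv).1
  have hfσ : ∀ x ∈ σ, f x = 0 := fun x hx => by rw [← hz] at hx; exact (mem_zs.1 hx).2
  have hgv : g v = 1 := by rw [hg v hv]; simp
  have hg0 : ∀ x ∈ σ.erase v, g x = 0 := fun x hx => by
    rw [hg x (mem_erase.1 hx).2, if_neg (mem_erase.1 hx).1]
  set k := g - t • f with hk
  have hkx : ∀ x, k x = g x - t * f x := fun x => by simp [hk]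
  have hkA : k ∈ A := A.sub_mem hgA (A.smul_mem _ hfA)
  have hkNN : NN X k := by
    intro x hx
    rw [hkx]
    by_cases hn : x ∈ σ
    · rw [hfσ x hn, hg x hn]; split_ifs <;> norm_num
    · linarith [hle x hx (hf.pos hx (by rwa [hz]))]
  have hkv : k v = 1 := by rw [hkx, hfσ v hv, hgv]; ring
  have hk0 : k x0 = 0 := by rw [hkx, heq]; ring
  have hke : ∀ x ∈ σ.erase v, k x = 0 := fun x hx => by
    rw [hkx, hg0 x hx, hfσ x (mem_erase.1 hx).2]; ring
  -- decomposition
  have dec : ∀ q ∈ A, (∀ x ∈ σ.erase v, q x = 0) → ∃ c : ℝ, ∀ x ∈ X, q x = q v * k x + c * f x := by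
    intro q hq hq0
    obtain ⟨c, hc⟩ := hfct (q - q v • g) (A.sub_mem hq (A.smul_mem _ hgA)) (fun x hx => by
      simp only [Pi.sub_apply, Pi.smul_apply, smul_eq_mul]
      by_cases hxv : x = v
      · rw [hxv, hgv]; ring
      · rw [hq0 x (mem_erase.2 ⟨hxv, hx⟩), hg0 x (mem_erase.2 ⟨hxv, hx⟩)]; ring)
    refine ⟨c + q v * t, fun x hx => ?_⟩
    have := hc x hx
    simp only [Pi.sub_apply, Pi.smul_apply, smul_eq_mul] at this
    rw [hkx]; linarith
  have hsub : σ.erase v ⊆ zs X k := fun x hx => by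
    have hxσ : x ∈ σ := (mem_erase.1 hx).2
    rw [← hz] at hxσ
    exact mem_zs.2 ⟨(mem_zs.1 hxσ).1, hke x hx⟩
  refine ⟨zs X k, ?_, ⟨k, hkA, hkNN, ⟨v, hvX, by rw [hkv]; norm_num⟩, rfl, ?_⟩, hsub, ?_⟩
  · intro hh
    rw [← hh] at hv
    have := (mem_zs.1 hv).2
    rw [hkv] at this; norm_num at this
  · intro q hq hq0
    obtain ⟨c, hc⟩ := dec q hq (fun x hx => hq0 x (hsub hx))
    have h1 := hc x0 hx0
    rw [hq0 x0 (mem_zs.2 ⟨hx0, hk0⟩), hk0] at h1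
    have : c = 0 := by
      have : c * f x0 = 0 := by linarith
      exact (mul_eq_zero.1 this).resolve_right hp0.ne'
    exact ⟨q v, fun x hx => by rw [hc x hx, this]; ring⟩
  · rintro τ ⟨q, hqA, hq, ⟨y, hy, hqy⟩, hqz, hqf⟩ hτ
    have hq0 : ∀ x ∈ σ.erase v, q x = 0 := fun x hx => by
      have := hτ hx
      rw [← hqz] at this; exact (mem_zs.1 this).2
    obtain ⟨c, hc⟩ := dec q hqA hq0
    have ha : 0 ≤ q v := hq v hvX
    have hcn : 0 ≤ c := by
      have h1 := hc x0 hx0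
      rw [hk0] at h1
      have h2 := hq x0 hx0
      by_contra hlt
      push Not at hlt
      nlinarith
    rcases ha.eq_or_lt with ha | ha
    · left
      rw [← hqz, ← hz]
      rw [← ha] at hc
      have hcne : c ≠ 0 := by
        rintro rfl
        apply hqy; rw [hc y hy]; ring
      ext x
      rw [mem_zs, mem_zs]
      refine and_congr_right fun hx => ?_
      rw [hc x hx]; simp [hcne]
    rcases hcn.eq_or_lt with hc0 | hc0
    · right
      rw [← hqz]
      ext x
      rw [mem_zs, mem_zs]
      refine and_congr_right fun hx => ?_
      rw [hc x hx, ← hc0]; simp [ha.ne']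
    · exfalso
      obtain ⟨c', hc'⟩ := hqf f hfA (fun x hx => by
        rw [← hqz] at hx
        obtain ⟨hxX, hx0⟩ := mem_zs.1 hx
        rw [hc x hxX] at hx0
        have h1 := hkNN x hxX
        have h2 := hf x hxX
        have h3 : 0 ≤ q v * k x := by positivity
        have h4 : 0 ≤ c * f x := by positivity
        have h5 : c * f x = 0 := by linarith
        exact (mul_eq_zero.1 h5).resolve_left hc0.ne')
      have h1 := hc' v hvX
      rw [hfσ v hv] at h1
      have h2 : c' = 0 := (mul_eq_zero.1 h1.symm).resolve_right ha.ne'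
      have h3 := hc' x0 hx0
      rw [h2, zero_mul] at h3
      exact hp0.ne' h3

theorem conn_lemma {Face : Finset α → Prop} {τ Z : Finset α} {p : α → ℝ}
    (hmono : ∀ a b, Face a → b ⊆ a → Face b)
    (h1 : ∀ a, Face a → ∃ f ∈ A, NN X f ∧ zs X f = a)
    (h2 : ∀ k ∈ A, NN X k → (∃ x ∈ X, k x ≠ 0) → τ ⊆ zs X k → (∃ x ∈ zs X k, x ∉ Z) →
      Face (zs X k))
    (hpA : p ∈ A) (hp : NN X p) (hZ : zs X p = Z) (hτ : τ ⊆ Z)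
    (h3 : (∃ y ∈ Z, y ∉ τ) ∨ ∀ u ∈ X, u ∉ Z → Face (insert u τ) →
      ∃ w ∈ X, w ∉ Z ∧ w ≠ u ∧ Face (insert w (insert u τ)))
    (S : Set α) (hS : ∀ x y, x ≠ y → x ∈ X → y ∈ X → x ∉ Z → y ∉ Z →
      Face (insert x (insert y τ)) → x ∈ S → y ∈ S)
    {u' : α} (hu' : u' ∈ X) (huZ' : u' ∉ Z) (hF' : Face (insert u' τ)) :
    ∀ (N : ℕ) (h' : α → ℝ), h' ∈ A → NN X h' → zs X h' = insert u' τ → 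
     ∀ u, ((X \ Z).filter (fun x => h' x / p x < h' u / p u)).card = N →
      u ∈ X → u ∉ Z → Face (insert u τ) → u ∈ S → u' ∈ S := by
  intro N h' hA' hNN' hz'
  induction N using Nat.strong_induction_on with
  | _ N ih =>
  intro u hN hu huZ hF huS
  by_cases huu : u = u'
  · rw [← huu]; exact huS
  have ppos : ∀ x ∈ X, x ∉ Z → 0 < p x := fun x hx hn => hp.pos hx (by rwa [hZ])
  have hτ' : ∀ x ∈ τ, h' x = 0 := fun x hx => by
    have : x ∈ zs X h' := by rw [hz']; simp [hx]
    exact (mem_zs.1 this).2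
  have hτp : ∀ x ∈ Z, p x = 0 := fun x hx => by
    rw [← hZ] at hx; exact (mem_zs.1 hx).2
  have hpu := ppos u hu huZ
  have hu'0 : h' u' = 0 := by
    have : u' ∈ zs X h' := by rw [hz']; simp
    exact (mem_zs.1 this).2
  have hh'u : 0 < h' u := hNN'.pos hu (by
    rw [hz', mem_insert, not_or]; exact ⟨huu, fun hh => huZ (hτ hh)⟩)
  set r := h' u / p u with hr
  have hrpos : 0 < r := div_pos hh'u hpu
  obtain ⟨hf, hfA, hfN, hfz⟩ := h1 _ hF
  have hfu0 : ∀ x ∈ insert u τ, hf x = 0 := fun x hx => by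
    rw [← hfz] at hx; exact (mem_zs.1 hx).2
  have hfpos : ∀ x ∈ X, x ∉ insert u τ → 0 < hf x := fun x hx hn => hfN.pos hx (by rwa [hfz])
  have hfu' : 0 < hf u' := hfpos u' hu' (by
    rw [mem_insert, not_or]; exact ⟨fun h => huu h.symm, fun hh => huZ' (hτ hh)⟩)
  obtain ⟨t, x0, hx0, hx0p, heq, hle⟩ := rot (h' - r • p) ⟨u', hu', hfu'⟩
  have hth : ∀ x, (h' - r • p) x = h' x - r * p x := fun x => by simp
  rw [hth] at heq
  have ht : t < 0 := by
    have := hle u' hu' hfu'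
    rw [hth, hu'0] at this
    have h5 := mul_pos hrpos (ppos u' hu' huZ')
    by_contra hlt
    push Not at hlt
    nlinarith
  set k := (h' - r • p) - t • hf with hk
  have hkx : ∀ x, k x = h' x - r * p x - t * hf x := fun x => by simp [hk]
  have hkA : k ∈ A := A.sub_mem (A.sub_mem hA' (A.smul_mem _ hpA)) (A.smul_mem _ hfA)
  have hk0 : ∀ x ∈ insert u τ, k x = 0 := by
    intro x hx
    rw [hkx, hfu0 x hx]
    rcases mem_insert.1 hx with rfl | hx
    · rw [hr]; field_simp; ring
    · rw [hτ' x hx, hτp x (hτ hx)]; ring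
  have hkN : NN X k := by
    intro x hx
    by_cases hn : x ∈ insert u τ
    · rw [hk0 x hn]
    · have := hle x hx (hfpos x hx hn)
      rw [hth] at this
      rw [hkx]; linarith
  have hkx0 : k x0 = 0 := by rw [hkx, heq]; ring
  have hx0lt : h' x0 < r * p x0 := by nlinarith
  have hpx0 : 0 < p x0 := by
    have h5 := hNN' x0 hx0
    have h6 : 0 < r * p x0 := by linarith
    exact (pos_iff_pos_of_mul_pos h6).1 hrpos
  have hx0Z : x0 ∉ Z := fun hh => hpx0.ne' (hτp x0 hh)
  have hrx0 : h' x0 / p x0 < r := by rwa [div_lt_iff₀ hpx0]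
  have hx0u : x0 ≠ u := by rintro rfl; exact lt_irrefl _ hrx0
  -- descend
  have desc : ∀ w ∈ X, w ∉ Z → w ≠ u → h' w / p w < r → Face (insert w (insert u τ)) → u' ∈ S := by
    intro w hw hwZ hwu hwr hwF
    have hwS : w ∈ S := hS u w hwu.symm hu hw huZ hwZ (by rwa [insert_comm]) huS
    refine ih _ ?_ w rfl hw hwZ (hmono _ _ hwF ?_) hwS
    · rw [← hN]
      apply card_lt_card
      refine ⟨fun x hx => ?_, fun hh => ?_⟩
      · simp only [mem_filter] at hx ⊢
        exact ⟨hx.1, hx.2.trans hwr⟩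
      · have := hh (mem_filter.2 ⟨mem_sdiff.2 ⟨hw, hwZ⟩, hwr⟩)
        exact lt_irrefl _ (mem_filter.1 this).2
    · exact insert_subset_insert _ (subset_insert _ _)
  by_cases hkne : ∃ x ∈ X, k x ≠ 0
  · have hτX : ∀ x ∈ insert u τ, x ∈ X := fun x hx => by
      rw [← hfz] at hx; exact (mem_zs.1 hx).1
    have hsub : insert u τ ⊆ zs X k := fun x hx => mem_zs.2 ⟨hτX x hx, hk0 x hx⟩
    have hkF := h2 k hkA hkN hkne ((subset_insert _ _).trans hsub) ⟨u, hsub (by simp), huZ⟩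
    refine desc x0 hx0 hx0Z hx0u hrx0 (hmono _ _ hkF ?_)
    exact insert_subset (mem_zs.2 ⟨hx0, hkx0⟩) hsub
  · push Not at hkne
    rcases h3 with ⟨y, hyZ, hyτ⟩ | h3
    · exfalso
      have hyX : y ∈ X := by rw [← hZ] at hyZ; exact (mem_zs.1 hyZ).1
      have h5 := hkne y hyX
      rw [hkx, hτp y hyZ] at h5
      have h6 := hNN' y hyX
      have h7 := hfpos y hyX (by
        rw [mem_insert, not_or]; exact ⟨fun h => huZ (h ▸ hyZ), hyτ⟩)
      nlinarith
    · obtain ⟨w, hw, hwZ, hwu, hwF⟩ := h3 u hu huZ hF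
      refine desc w hw hwZ hwu ?_ hwF
      rw [div_lt_iff₀ (ppos w hw hwZ)]
      have h5 := hkne w hw
      rw [hkx] at h5
      have h7 := hfpos w hw (by
        rw [mem_insert, not_or]; exact ⟨hwu, fun hh => hwZ (hτ hh)⟩)
      nlinarith
end geo1

section geo2
variable {α : Type*} [DecidableEq α]

theorem exists_not_mem_of_card_lt {s t : Finset α} (h : s.card < t.card) : ∃ x ∈ t, x ∉ s := by
  by_contra hh
  push Not at hh
  exact absurd (card_le_card (show t ⊆ s from hh)) (by omega)

/-- abstract almost simplicial configuration -/
structure Cfg (d : ℕ) (A : Submodule ℝ (α → ℝ)) (X W : Finset α) : Prop where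
  two : 2 ≤ d
  fW : Fct A X W
  card : ∀ σ, Fct A X σ → σ ≠ W → σ.card = d + 1
  pre : ∀ σ, Fct A X σ → σ ≠ W → Pre A σ
  vert : ∀ x ∈ X, ∃ f ∈ A, NN X f ∧ zs X f = {x}
  cW : d + 1 ≤ W.card

open scoped Classical in
/-- the facets other than `W` -/
def fcts (A : Submodule ℝ (α → ℝ)) (X W : Finset α) : Finset (Finset α) :=
  X.powerset.filter (fun σ => Fct A X σ ∧ σ ≠ W)

theorem mem_fcts {A : Submodule ℝ (α → ℝ)} {X W σ : Finset α} :
    σ ∈ fcts A X W ↔ Fct A X σ ∧ σ ≠ W := by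
  simp only [fcts, mem_filter, mem_powerset]
  exact ⟨fun h => h.2, fun h => ⟨h.1.sub, h⟩⟩

variable {d : ℕ} {A : Submodule ℝ (α → ℝ)} {X W : Finset α}

theorem Cfg.F2 (H : Cfg d A X W) {f : α → ℝ} (hA : f ∈ A) (hN : NN X f)
    (h0 : ∃ x ∈ X, f x ≠ 0) (hW : zs X f ≠ W) : IsFc (fcts A X W) (zs X f) := by
  obtain ⟨σ, h1, h2⟩ := exists_fct _ f rfl hA hN h0
  by_cases hσ : σ = W
  · subst hσ
    obtain ⟨p, hpA, hp, hp0, hpz, hpf⟩ := H.fW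
    obtain ⟨t, x0, hx0, hpx0, heq, hle⟩ := rot f (exists_pos hp hp0)
    set k := f - t • p with hk
    have hkx : ∀ x, k x = f x - t * p x := fun x => by simp [hk]
    have hkA : k ∈ A := A.sub_mem hA (A.smul_mem _ hpA)
    have hkN : NN X k := by
      intro x hx
      rw [hkx]
      by_cases hn : x ∈ zs X p
      · rw [(mem_zs.1 hn).2]; simpa using hN x hx
      · linarith [hle x hx (hp.pos hx hn)]
    have hk0 : k x0 = 0 := by rw [hkx, heq]; ring
    have hx0σ : x0 ∉ σ := by
      rw [← hpz]; exact fun h => hpx0.ne' (mem_zs.1 h).2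
    have hpσ : ∀ x ∈ σ, p x = 0 := fun x hx => by rw [← hpz] at hx; exact (mem_zs.1 hx).2
    have hkne : ∃ x ∈ X, k x ≠ 0 := by
      by_contra hh
      push Not at hh
      apply hW
      apply Subset.antisymm h2
      intro x hx
      have h4 := hh x (h1.sub hx)
      rw [hkx, hpσ x hx] at h4
      exact mem_zs.2 ⟨h1.sub hx, by linarith⟩
    obtain ⟨σ', h3, h4⟩ := exists_fct _ k rfl hkA hkN hkne
    refine ⟨σ', mem_fcts.2 ⟨h3, ?_⟩, ?_⟩
    · rintro rfl
      exact hx0σ (h4 (mem_zs.2 ⟨hx0, hk0⟩))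
    · intro x hx
      apply h4
      refine mem_zs.2 ⟨(mem_zs.1 hx).1, ?_⟩
      rw [hkx, (mem_zs.1 hx).2, hpσ x (h2 hx)]; ring
  · exact ⟨σ, mem_fcts.2 ⟨h1, hσ⟩, h2⟩

theorem Cfg.F1 (H : Cfg d A X W) {τ : Finset α} (h : IsFc (fcts A X W) τ) :
    ∃ f ∈ A, NN X f ∧ zs X f = τ := by
  obtain ⟨σ, h1, h2⟩ := h
  rw [mem_fcts] at h1
  obtain ⟨g, hgA, hg⟩ := H.pre σ h1.1 h1.2 (fun x => if x ∈ τ then 0 else 1)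
  obtain ⟨f, hfA, hf, h0, hz, hfct⟩ := h1.1
  obtain ⟨M, hM1, hM2⟩ := perturb (f := f) (g := g) hf (by
    rw [hz]; intro x hx; rw [hg x hx]; split_ifs <;> norm_num)
  refine ⟨_, A.add_mem (A.smul_mem _ hfA) hgA, hM1, ?_⟩
  ext x
  rw [hM2, hz]
  constructor
  · rintro ⟨h3, h4⟩
    rw [hg x h3] at h4
    by_contra hh
    rw [if_neg hh] at h4; norm_num at h4
  · intro hx
    exact ⟨h2 hx, by rw [hg x (h2 hx), if_pos hx]⟩

theorem Cfg.isFc_sub {τ : Finset α} (h : IsFc (fcts A X W) τ) : τ ⊆ X := by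
  obtain ⟨σ, h1, h2⟩ := h
  exact h2.trans (mem_fcts.1 h1).1.sub

theorem Cfg.vert_isFc (H : Cfg d A X W) {x : α} (hx : x ∈ X) : IsFc (fcts A X W) {x} := by
  obtain ⟨f, hfA, hf, hz⟩ := H.vert x hx
  have hW := H.cW
  have h2 := H.two
  rw [← hz]
  have hne : zs X f ≠ W := by
    rw [hz]; rintro rfl; simp at hW; omega
  refine H.F2 hfA hf ?_ hne
  obtain ⟨y, hy, hyx⟩ := exists_not_mem_of_card_lt (s := {x}) (t := W) (by simp; omega)
  refine ⟨y, H.fW.sub hy, fun h => hyx ?_⟩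
  rw [← hz]; exact mem_zs.2 ⟨H.fW.sub hy, h⟩

theorem Cfg.vs_eq (H : Cfg d A X W) : vs (fcts A X W) = X := by
  ext x
  rw [mem_vs]
  exact ⟨fun h => Cfg.isFc_sub h (by simp), fun h => H.vert_isFc h⟩

theorem Cfg.nW (H : Cfg d A X W) {σ : Finset α} (h : σ ∈ fcts A X W) : ¬ σ ⊆ W := by
  intro hs
  rw [mem_fcts] at h
  obtain ⟨p, hpA, hp, ⟨y, hy, hp0⟩, hpz, hpf⟩ := H.fW
  obtain ⟨f, hfA, hf, h0, hz, hfct⟩ := h.1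
  obtain ⟨c, hc⟩ := hfct p hpA (fun x hx => by
    have := hs hx
    rw [← hpz] at this; exact (mem_zs.1 this).2)
  apply h.2
  have hc0 : c ≠ 0 := by
    rintro rfl
    apply hp0; rw [hc y hy]; ring
  rw [← hz, ← hpz]
  ext x
  rw [mem_zs, mem_zs]
  refine and_congr_right fun hx => ?_
  rw [hc x hx]; simp [hc0]

theorem Cfg.ne (H : Cfg d A X W) : (fcts A X W).Nonempty := by
  have h1 := H.cW
  obtain ⟨x, hx⟩ : W.Nonempty := card_pos.1 (by omega)
  obtain ⟨σ, h1, _⟩ := H.vert_isFc (H.fW.sub hx)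
  exact ⟨σ, h1⟩

theorem eq_erase {ρ σ : Finset α} (h : ρ ⊆ σ) (hc : ρ.card + 1 = σ.card) :
    ∃ v ∈ σ, ρ = σ.erase v := by
  obtain ⟨v, hv, hvρ⟩ := exists_not_mem_of_card_lt (s := ρ) (t := σ) (by omega)
  refine ⟨v, hv, eq_of_subset_of_card_le (fun x hx => mem_erase.2 ⟨?_, h hx⟩) ?_⟩
  · rintro rfl; exact hvρ hx
  · rw [card_erase_of_mem hv]; omega

theorem Cfg.ridge (H : Cfg d A X W) {ρ : Finset α} (hc : ρ.card = d)
    (h : IsFc (fcts A X W) ρ) : ∃ σ ∈ fcts A X W, ρ ⊆ σ ∧ ∃ σ2, σ2 ≠ σ ∧ Fct A X σ2 ∧ ρ ⊆ σ2 ∧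
      ∀ τ, Fct A X τ → ρ ⊆ τ → τ = σ ∨ τ = σ2 := by
  obtain ⟨σ, h1, h2⟩ := h
  have h1' := mem_fcts.1 h1
  obtain ⟨v, hv, rfl⟩ := eq_erase h2 (by rw [H.card σ h1'.1 h1'.2, hc])
  exact ⟨σ, h1, h2, ridge_lemma h1'.1 (H.pre σ h1'.1 h1'.2) hv⟩

theorem Cfg.ridge2 (H : Cfg d A X W) {ρ : Finset α} (hc : ρ.card = d)
    (h : IsFc (fcts A X W) ρ) (hW : ¬ ρ ⊆ W) :
    ((fcts A X W).filter (fun σ => ρ ⊆ σ)).card = 2 := by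
  obtain ⟨σ, h1, h2, σ2, h3, h4, h5, h6⟩ := H.ridge hc h
  rw [card_eq_two]
  refine ⟨σ, σ2, h3.symm, ?_⟩
  ext τ
  simp only [mem_filter, mem_insert, mem_singleton]
  constructor
  · rintro ⟨h7, h8⟩; exact h6 τ (mem_fcts.1 h7).1 h8
  · rintro (rfl | rfl)
    · exact ⟨h1, h2⟩
    · refine ⟨mem_fcts.2 ⟨h4, ?_⟩, h5⟩
      rintro rfl; exact hW h5

theorem Cfg.ridge1 (H : Cfg d A X W) {ρ : Finset α} (hc : ρ.card = d)
    (h : IsFc (fcts A X W) ρ) (hW : ρ ⊆ W) :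
    ((fcts A X W).filter (fun σ => ρ ⊆ σ)).card = 1 := by
  obtain ⟨σ, h1, h2, σ2, h3, h4, h5, h6⟩ := H.ridge hc h
  have h7 : σ2 = W := by
    rcases h6 W H.fW hW with rfl | h7
    · exact absurd rfl (mem_fcts.1 h1).2
    · exact h7.symm
  rw [card_eq_one]
  refine ⟨σ, ?_⟩
  ext τ
  simp only [mem_filter, mem_singleton]
  constructor
  · rintro ⟨h8, h9⟩
    rcases h6 τ (mem_fcts.1 h8).1 h9 with h | h
    · exact h
    · exact absurd (h.trans h7) (mem_fcts.1 h8).2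
  · rintro rfl; exact ⟨h1, h2⟩

theorem Cfg.ofW (H : Cfg d A X W) {k : α → ℝ} (hk : k ∈ A) (hN : NN W k) (h0 : ∃ x ∈ W, k x ≠ 0) :
    IsFc (fcts A X W) (zs W k) := by
  obtain ⟨p, hpA, hp, hp0, hpz, hpf⟩ := H.fW
  obtain ⟨M, hM1, hM2⟩ := perturb (f := p) (g := k) hp (by rw [hpz]; exact hN)
  have he : zs X (M • p + k) = zs W k := by
    ext x; rw [hM2, hpz, mem_zs]
  obtain ⟨y, hy, hyk⟩ := h0
  have hyn : y ∉ zs W k := fun h => hyk (mem_zs.1 h).2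
  rw [← he] at hyn ⊢
  refine H.F2 (A.add_mem (A.smul_mem _ hpA) hk) hM1 ⟨y, H.fW.sub hy, fun h => hyn ?_⟩ ?_
  · exact mem_zs.2 ⟨H.fW.sub hy, h⟩
  · intro h; rw [h] at hyn; exact hyn hy

theorem Cfg.BD (H : Cfg d A X W) {ρ : Finset α} (h : Fct A W ρ) :
    IsFc (fcts A X W) ρ ∧ ρ ⊆ W ∧ ρ.card = d := by
  obtain ⟨f0, hA0, hN0, h00, hz0, hf0⟩ := id h
  have hF : IsFc (fcts A X W) ρ := by rw [← hz0]; exact H.ofW hA0 hN0 h00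
  refine ⟨hF, h.sub, ?_⟩
  obtain ⟨σ, h1, h2⟩ := hF
  have h1' := mem_fcts.1 h1
  have hcσ := H.card σ h1'.1 h1'.2
  obtain ⟨u, hu, huW⟩ := not_subset.1 (H.nW h1)
  have huρ : u ∉ ρ := fun hh => huW (h.sub hh)
  have hle : ρ.card ≤ d := by
    have := card_lt_card (Finset.ssubset_iff_subset_ne.2 ⟨h2, fun hh => huρ (hh ▸ hu)⟩)
    omega
  by_contra hne
  obtain ⟨v, hv, hvn⟩ := exists_not_mem_of_card_lt (s := insert u ρ) (t := σ) (by
    rw [card_insert_of_notMem huρ]; omega)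
  rw [mem_insert, not_or] at hvn
  obtain ⟨p, hpA, hp, hp0, hpz, hpf⟩ := H.fW
  have hpW : ∀ x ∈ W, p x = 0 := fun x hx => by rw [← hpz] at hx; exact (mem_zs.1 hx).2
  have dec : ∀ g ∈ A, (∀ x ∈ ρ, g x = 0) → ∃ a b : ℝ, ∀ x ∈ X, g x = a * f0 x + b * p x := by
    intro g hg hgρ
    obtain ⟨a, ha⟩ := hf0 g hg hgρ
    obtain ⟨b, hb⟩ := hpf (g - a • f0) (A.sub_mem hg (A.smul_mem _ hA0)) (fun x hx => by
      simp [ha x hx])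
    refine ⟨a, b, fun x hx => ?_⟩
    have := hb x hx
    simp only [Pi.sub_apply, Pi.smul_apply, smul_eq_mul] at this
    linarith
  obtain ⟨g1, hg1A, hg1⟩ := H.pre σ h1'.1 h1'.2 (fun x => if x = u then 1 else 0)
  obtain ⟨g2, hg2A, hg2⟩ := H.pre σ h1'.1 h1'.2 (fun x => if x = v then 1 else 0)
  obtain ⟨f, hfA, hf, ⟨y, hy, hfy⟩, hz, hfct⟩ := h1'.1
  have hfσ : ∀ x ∈ σ, f x = 0 := fun x hx => by rw [← hz] at hx; exact (mem_zs.1 hx).2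
  obtain ⟨a1, b1, e1⟩ := dec g1 hg1A (fun x hx => by
    rw [hg1 x (h2 hx), if_neg]; rintro rfl; exact huρ hx)
  obtain ⟨a2, b2, e2⟩ := dec g2 hg2A (fun x hx => by
    rw [hg2 x (h2 hx), if_neg]; rintro rfl; exact hvn.2 hx)
  obtain ⟨a3, b3, e3⟩ := dec f hfA (fun x hx => hfσ x (h2 hx))
  have huX := Fct.sub h1'.1 hu
  have hvX := Fct.sub h1'.1 hv
  have E1 := e1 u huX
  have E2 := e1 v hvX
  have E3 := e2 u huX
  have E4 := e2 v hvX
  have E5 := e3 u huX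
  have E6 := e3 v hvX
  rw [hg1 u hu, if_pos rfl] at E1
  rw [hg1 v hv, if_neg hvn.1] at E2
  rw [hg2 u hu, if_neg (Ne.symm hvn.1)] at E3
  rw [hg2 v hv, if_pos rfl] at E4
  rw [hfσ u hu] at E5
  rw [hfσ v hv] at E6
  have hdet : (a1 * b2 - a2 * b1) * (f0 u * p v - f0 v * p u) = 1 := by
    have : (a1 * b2 - a2 * b1) * (f0 u * p v - f0 v * p u) =
      (a1 * f0 u + b1 * p u) * (a2 * f0 v + b2 * p v) -
      (a1 * f0 v + b1 * p v) * (a2 * f0 u + b2 * p u) := by ring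
    rw [this, ← E1, ← E2, ← E3, ← E4]; ring
  have hΔ : f0 u * p v - f0 v * p u ≠ 0 := by
    intro hh; rw [hh] at hdet; norm_num at hdet
  have ha3 : a3 = 0 := by
    have : a3 * (f0 u * p v - f0 v * p u) = 0 := by linear_combination (-p v) * E5 + p u * E6
    exact (mul_eq_zero.1 this).resolve_right hΔ
  have hb3 : b3 = 0 := by
    have : b3 * (f0 u * p v - f0 v * p u) = 0 := by linear_combination f0 v * E5 - f0 u * E6
    exact (mul_eq_zero.1 this).resolve_right hΔ
  apply hfy
  rw [e3 y hy, ha3, hb3]; ring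

theorem Cfg.BD' (H : Cfg d A X W) {ρ : Finset α} (h : IsFc (fcts A X W) ρ) (hW : ρ ⊆ W)
    (hc : ρ.card = d) : Fct A W ρ := by
  obtain ⟨σ, h1, h2⟩ := h
  have h1' := mem_fcts.1 h1
  obtain ⟨v, hv, rfl⟩ := eq_erase h2 (by rw [H.card σ h1'.1 h1'.2, hc])
  have hvW : v ∉ W := fun hh => H.nW h1 (fun x hx => by
    by_cases hxv : x = v
    · rwa [hxv]
    · exact hW (mem_erase.2 ⟨hxv, hx⟩))
  obtain ⟨f, hfA, hf, h0, hz, hfct⟩ := h1'.1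
  obtain ⟨p, hpA, hp, hp0, hpz, hpf⟩ := H.fW
  have hpW : ∀ x ∈ W, p x = 0 := fun x hx => by rw [← hpz] at hx; exact (mem_zs.1 hx).2
  have hvX := Fct.sub h1'.1 hv
  have hpv : p v ≠ 0 := fun h => hvW (by rw [← hpz]; exact mem_zs.2 ⟨hvX, h⟩)
  have hWX := H.fW.sub
  have hzW : zs W f = σ.erase v := by
    ext x
    rw [mem_zs, mem_erase]
    constructor
    · rintro ⟨h3, h4⟩
      refine ⟨fun h => hvW (h ▸ h3), ?_⟩
      rw [← hz]; exact mem_zs.2 ⟨hWX h3, h4⟩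
    · rintro ⟨h3, h4⟩
      refine ⟨hW (mem_erase.2 ⟨h3, h4⟩), ?_⟩
      rw [← hz] at h4; exact (mem_zs.1 h4).2
  have hcW := H.cW
  obtain ⟨y, hy, hyn⟩ := exists_not_mem_of_card_lt (s := σ.erase v) (t := W) (by omega)
  refine ⟨f, hfA, fun x hx => hf x (hWX hx), ⟨y, hy, fun hh => hyn ?_⟩, hzW, ?_⟩
  · rw [← hzW]; exact mem_zs.2 ⟨hy, hh⟩
  · intro g hg hg0
    obtain ⟨c, hc⟩ := hfct (g - (g v / p v) • p) (A.sub_mem hg (A.smul_mem _ hpA)) (fun x hx => by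
      simp only [Pi.sub_apply, Pi.smul_apply, smul_eq_mul]
      by_cases hxv : x = v
      · rw [hxv]; field_simp; ring
      · have := mem_erase.2 ⟨hxv, hx⟩
        rw [hg0 x this, hpW x (hW this)]; ring)
    refine ⟨c, fun x hx => ?_⟩
    have := hc x (hWX hx)
    simp only [Pi.sub_apply, Pi.smul_apply, smul_eq_mul, hpW x hx] at this
    linarith

theorem Cfg.ext (H : Cfg d A X W) {τ : Finset α} (h : IsFc (fcts A X W) τ) (hW : τ ⊆ W) :
    ∃ ρ, τ ⊆ ρ ∧ ρ.card = d ∧ IsFc (fcts A X W) ρ ∧ ρ ⊆ W := by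
  obtain ⟨f, hfA, hf, hz⟩ := H.F1 h
  have hWX := H.fW.sub
  have hn : ∃ y ∈ W, y ∉ τ := by
    by_contra hh
    push Not at hh
    obtain ⟨σ, h1, h2⟩ := h
    have h1' := mem_fcts.1 h1
    have h3 : W ⊆ σ := Subset.trans hh h2
    have h4 := H.cW
    have h5 := H.card σ h1'.1 h1'.2
    exact h1'.2 (eq_of_subset_of_card_le h3 (by omega)).symm
  obtain ⟨y, hy, hyn⟩ := hn
  obtain ⟨ρ, h1, h2⟩ := exists_fct (X := W) _ f rfl hfA (fun x hx => hf x (hWX hx))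
    ⟨y, hy, fun hh => hyn (by rw [← hz]; exact mem_zs.2 ⟨hWX hy, hh⟩)⟩
  obtain ⟨h3, h4, h5⟩ := H.BD h1
  refine ⟨ρ, fun x hx => h2 (mem_zs.2 ⟨hW hx, ?_⟩), h5, h3, h4⟩
  rw [← hz] at hx; exact (mem_zs.1 hx).2

theorem Cfg.mem_bd {ρ : Finset α} :
    ρ ∈ bd d (fcts A X W) W ↔ IsFc (fcts A X W) ρ ∧ ρ ⊆ W ∧ ρ.card = d := by
  simp only [bd, mem_filter, mem_fc]; tauto

theorem Cfg.isFc_bd (H : Cfg d A X W) {τ : Finset α} :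
    IsFc (bd d (fcts A X W) W) τ ↔ IsFc (fcts A X W) τ ∧ τ ⊆ W := by
  constructor
  · rintro ⟨ρ, h1, h2⟩
    rw [Cfg.mem_bd] at h1
    exact ⟨h1.1.mono h2, h2.trans h1.2.1⟩
  · rintro ⟨h1, h2⟩
    obtain ⟨ρ, h3, h4, h5, h6⟩ := H.ext h1 h2
    exact ⟨ρ, Cfg.mem_bd.2 ⟨h5, h6, h4⟩, h3⟩

theorem Cfg.connX (H : Cfg d A X W) (τ : Finset α) (hτ : τ.card + 2 ≤ d + 1)
    (hF : IsFc (fcts A X W) τ) (S : Set α)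
    (hS : ∀ x y, x ≠ y → x ∉ τ → y ∉ τ → (τ ⊆ W → x ∉ W ∧ y ∉ W) →
      IsFc (fcts A X W) (insert x (insert y τ)) → x ∈ S → y ∈ S)
    (x y : α) (hx : x ∉ τ) (hy : y ∉ τ) (hxy : τ ⊆ W → x ∉ W ∧ y ∉ W)
    (hFx : IsFc (fcts A X W) (insert x τ)) (hFy : IsFc (fcts A X W) (insert y τ)) (hxS : x ∈ S) :
    y ∈ S := by
  have hxX := Cfg.isFc_sub hFx (mem_insert_self _ _)
  have hyX := Cfg.isFc_sub hFy (mem_insert_self _ _)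
  obtain ⟨h', h1', h2', h3'⟩ := H.F1 hFy
  by_cases hW : τ ⊆ W
  · obtain ⟨p, hpA, hp, hp0, hpz, hpf⟩ := H.fW
    have hcW := H.cW
    refine conn_lemma (A := A) (X := X) (Face := IsFc (fcts A X W)) (τ := τ) (Z := W) (p := p)
      (fun a b h hb => h.mono hb) (fun a h => H.F1 h) ?_ hpA hp hpz hW ?_ S ?_ hyX (hxy hW).2
      hFy _ h' h1' h2' h3' x rfl hxX (hxy hW).1 hFx hxS
    · rintro k hk hkN hk0 - ⟨z, hz, hzW⟩
      exact H.F2 hk hkN hk0 (fun h => hzW (h ▸ hz))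
    · left
      exact exists_not_mem_of_card_lt (by omega)
    · intro a b hab _ _ haW hbW
      exact hS a b hab (fun h => haW (hW h)) (fun h => hbW (hW h)) (fun _ => ⟨haW, hbW⟩)
  · obtain ⟨p, hpA, hp, hpz⟩ := H.F1 hF
    refine conn_lemma (A := A) (X := X) (Face := IsFc (fcts A X W)) (τ := τ) (Z := τ) (p := p)
      (fun a b h hb => h.mono hb) (fun a h => H.F1 h) ?_ hpA hp hpz Subset.rfl ?_ S ?_ hyX hy
      hFy _ h' h1' h2' h3' x rfl hxX hx hFx hxS
    · rintro k hk hkN hk0 hsub -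
      exact H.F2 hk hkN hk0 (fun h => hW (h ▸ hsub))
    · right
      rintro u huX huτ ⟨σ, h1, h2⟩
      have h1' := mem_fcts.1 h1
      have hcσ := H.card σ h1'.1 h1'.2
      obtain ⟨w, hw, hwn⟩ := exists_not_mem_of_card_lt (s := insert u τ) (t := σ) (by
        rw [card_insert_of_notMem huτ]; omega)
      rw [mem_insert, not_or] at hwn
      exact ⟨w, h1'.1.sub hw, hwn.2, hwn.1, σ, h1, insert_subset hw h2⟩
    · intro a b hab _ _ haτ hbτ
      exact hS a b hab haτ hbτ (fun h => absurd h hW)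

theorem Cfg.connW (H : Cfg d A X W) (τ : Finset α) (hτ : τ.card + 2 ≤ d)
    (hF : IsFc (bd d (fcts A X W) W) τ) (S : Set α)
    (hS : ∀ x y, x ≠ y → x ∉ τ → y ∉ τ →
      IsFc (bd d (fcts A X W) W) (insert x (insert y τ)) → x ∈ S → y ∈ S)
    (x y : α) (hx : x ∉ τ) (hy : y ∉ τ)
    (hFx : IsFc (bd d (fcts A X W) W) (insert x τ))
    (hFy : IsFc (bd d (fcts A X W) W) (insert y τ)) (hxS : x ∈ S) :
    y ∈ S := by
  have hWX := H.fW.sub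
  have hxX := (H.isFc_bd.1 hFx).2 (mem_insert_self _ _)
  have hyX := (H.isFc_bd.1 hFy).2 (mem_insert_self _ _)
  have F1 : ∀ a, IsFc (bd d (fcts A X W) W) a → ∃ f ∈ A, NN W f ∧ zs W f = a := by
    intro a ha
    rw [H.isFc_bd] at ha
    obtain ⟨f, hfA, hf, hz⟩ := H.F1 ha.1
    refine ⟨f, hfA, fun x hx => hf x (hWX hx), ?_⟩
    ext z
    rw [mem_zs, ← hz, mem_zs]
    constructor
    · rintro ⟨h1, h2⟩; exact ⟨hWX h1, h2⟩
    · rintro ⟨h1, h2⟩; exact ⟨ha.2 (by rw [← hz]; exact mem_zs.2 ⟨h1, h2⟩), h2⟩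
  obtain ⟨h', h1', h2', h3'⟩ := F1 _ hFy
  obtain ⟨p, hpA, hp, hpz⟩ := F1 _ hF
  refine conn_lemma (A := A) (X := W) (Face := IsFc (bd d (fcts A X W) W)) (τ := τ) (Z := τ) (p := p)
      (fun a b h hb => h.mono hb) F1 ?_ hpA hp hpz Subset.rfl ?_ S ?_ hyX hy
      hFy _ h' h1' h2' h3' x rfl hxX hx hFx hxS
  · rintro k hk hkN hk0 hsub -
    rw [H.isFc_bd]
    exact ⟨H.ofW hk hkN hk0, fun x hx => (mem_zs.1 hx).1⟩
  · right
    rintro u huX huτ ⟨σ, h1, h2⟩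
    have h1' := Cfg.mem_bd.1 h1
    obtain ⟨w, hw, hwn⟩ := exists_not_mem_of_card_lt (s := insert u τ) (t := σ) (by
      rw [card_insert_of_notMem huτ]; omega)
    rw [mem_insert, not_or] at hwn
    exact ⟨w, h1'.2.1 hw, hwn.2, hwn.1, σ, h1, insert_subset hw h2⟩
  · intro a b hab _ _ haτ hbτ
    exact hS a b hab haτ hbτ

theorem Cfg.bdridge2 (H : Cfg d A X W) {ρ : Finset α} (hc : ρ.card + 1 = d)
    (h : IsFc (bd d (fcts A X W) W) ρ) :
    ((bd d (fcts A X W) W).filter (fun σ => ρ ⊆ σ)).card = 2 := by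
  obtain ⟨σ, h1, h2⟩ := h
  have h1' := Cfg.mem_bd.1 h1
  obtain ⟨v, hv, rfl⟩ := eq_erase h2 (by rw [h1'.2.2, hc])
  have hpre : Pre A σ := by
    obtain ⟨σ', h3, h4⟩ := h1'.1
    rw [mem_fcts] at h3
    intro c
    obtain ⟨g, hg, hg'⟩ := H.pre σ' h3.1 h3.2 c
    exact ⟨g, hg, fun x hx => hg' x (h4 hx)⟩
  obtain ⟨σ2, h3, h4, h5, h6⟩ := ridge_lemma (H.BD' h1'.1 h1'.2.1 h1'.2.2) hpre hv
  rw [card_eq_two]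
  refine ⟨σ, σ2, h3.symm, ?_⟩
  ext τ
  simp only [mem_filter, mem_insert, mem_singleton]
  constructor
  · rintro ⟨h7, h8⟩
    rw [Cfg.mem_bd] at h7
    exact h6 τ (H.BD' h7.1 h7.2.1 h7.2.2) h8
  · rintro (rfl | rfl)
    · exact ⟨h1, h2⟩
    · exact ⟨Cfg.mem_bd.2 (H.BD h4), h5⟩

theorem Cfg.rel (H : Cfg d A X W) : Rel d (fcts A X W) W where
  pm := {
    ne := H.ne
    card := fun σ h => H.card σ (mem_fcts.1 h).1 (mem_fcts.1 h).2
    nW := fun σ h => H.nW h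
    ridge2 := fun ρ hc h hW => H.ridge2 (by omega) h hW
    conn := fun τ hτ hF S hS => H.connX τ hτ hF S hS }
  ridge1 := fun ρ hc h hW => H.ridge1 hc h hW
  ext := fun τ h hW => H.ext h hW
  bdPM := {
    ne := by
      obtain ⟨σ, h1⟩ := H.ne
      obtain ⟨ρ, _, h2, h3, h4⟩ := H.ext (τ := ∅) ⟨σ, h1, by simp⟩ (by simp)
      exact ⟨ρ, Cfg.mem_bd.2 ⟨h3, h4, h2⟩⟩
    card := fun σ h => (Cfg.mem_bd.1 h).2.2
    nW := fun σ h hs => by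
      have h1 := (Cfg.mem_bd.1 h).2.2
      have h2 := H.two
      rw [subset_empty.1 hs] at h1
      simp at h1; omega
    ridge2 := fun ρ hc h _ => H.bdridge2 hc h
    conn := fun τ hτ hF S hS x y hx hy _ => 
      H.connW τ hτ hF S (fun a b hab ha hb => hS a b hab ha hb (by simp)) x y hx hy }

theorem Cfg.inter (H : Cfg d A X W) : vs (fcts A X W) ∩ W = W := by
  rw [H.vs_eq]; exact inter_eq_right.2 H.fW.sub
end geo2

section geo3
variable {d : ℕ}

/-- affine functionals -/
def Aff (d : ℕ) : Submodule ℝ ((Fin d → ℝ) → ℝ) where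
  carrier := {f | ∃ (φ : Module.Dual ℝ (Fin d → ℝ)) (c : ℝ), ∀ x, f x = φ x + c}
  add_mem' := by
    rintro f g ⟨φ, c, h⟩ ⟨ψ, e, h'⟩
    exact ⟨φ + ψ, c + e, fun x => by simp [h, h']; ring⟩
  zero_mem' := ⟨0, 0, by simp⟩
  smul_mem' := by
    rintro r f ⟨φ, c, h⟩
    exact ⟨r • φ, r * c, fun x => by simp [h]; ring⟩

theorem mem_Aff {f : (Fin d → ℝ) → ℝ} :
    f ∈ Aff d ↔ ∃ (φ : Module.Dual ℝ (Fin d → ℝ)) (c : ℝ), ∀ x, f x = φ x + c := Iff.rfl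

theorem mem_ann {T : Set (Fin d → ℝ)} {φ : Module.Dual ℝ (Fin d → ℝ)} :
    φ ∈ (vectorSpan ℝ T).dualAnnihilator ↔ ∀ x ∈ T, ∀ y ∈ T, φ x = φ y := by
  rw [Submodule.mem_dualAnnihilator]
  constructor
  · intro h x hx y hy
    have := h (x -ᵥ y) (vsub_mem_vectorSpan ℝ hx hy)
    rw [vsub_eq_sub, map_sub] at this
    linarith
  · intro h w hw
    rw [vectorSpan_def] at hw
    induction hw using Submodule.span_induction with
    | mem z hz =>
      obtain ⟨x, hx, y, hy, rfl⟩ := hz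
      simp [h x hx y hy]
    | zero => simp
    | add x y _ _ hx hy => simp [hx, hy]
    | smul a x _ hx => simp [hx]

theorem polyDim_convexHull (T : Set (Fin d → ℝ)) :
    polyDim (convexHull ℝ T) = Module.finrank ℝ (vectorSpan ℝ T) := by
  rw [polyDim, affineSpan_convexHull, direction_affineSpan]

theorem ann_card (T : Set (Fin d → ℝ)) :
    polyDim (convexHull ℝ T) + Module.finrank ℝ (vectorSpan ℝ T).dualAnnihilator = d := by
  rw [polyDim_convexHull, Subspace.finrank_add_finrank_dualAnnihilator_eq]
  simp

theorem full_zero {X : Set (Fin d → ℝ)} (hX : polyDim (convexHull ℝ X) = d)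
    {φ : Module.Dual ℝ (Fin d → ℝ)} (h : ∀ x ∈ X, ∀ y ∈ X, φ x = φ y) : φ = 0 := by
  have h1 := ann_card X
  have h2 : Module.finrank ℝ (vectorSpan ℝ X).dualAnnihilator = 0 := by omega
  rw [Submodule.finrank_eq_zero] at h2
  rw [← mem_ann, h2] at h
  simpa using h

/-- face cut out by a functional -/
theorem cut_eq {X : Finset (Fin d → ℝ)} {f : (Fin d → ℝ) → ℝ} (hf : f ∈ Aff d) (hN : NN X f) :
    (∀ x ∈ convexHull ℝ (X : Set (Fin d → ℝ)), 0 ≤ f x) ∧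
    {x ∈ convexHull ℝ (X : Set (Fin d → ℝ)) | f x = 0} =
      convexHull ℝ (zs X f : Set (Fin d → ℝ)) := by
  obtain ⟨φ, c, h⟩ := hf
  have key : ∀ w : (Fin d → ℝ) → ℝ, ∑ y ∈ X, w y = 1 →
      f (∑ y ∈ X, w y • y) = ∑ y ∈ X, w y * f y := by
    intro w hw
    rw [h, map_sum]
    simp only [h, mul_add, sum_add_distrib, ← sum_mul, hw, map_smul, smul_eq_mul, one_mul]
  refine ⟨?_, Set.Subset.antisymm ?_ ?_⟩
  · intro x hx
    obtain ⟨w, hw, h1, rfl⟩ := Finset.mem_convexHull'.1 hx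
    rw [key w h1]
    exact sum_nonneg fun y hy => mul_nonneg (hw y hy) (hN y hy)
  · rintro x ⟨hx, hx0⟩
    obtain ⟨w, hw, h1, rfl⟩ := Finset.mem_convexHull'.1 hx
    rw [key w h1, sum_eq_zero_iff_of_nonneg (fun y hy => mul_nonneg (hw y hy) (hN y hy))] at hx0
    have hz : ∀ y ∈ X, y ∉ zs X f → w y = 0 := fun y hy hn =>
      (mul_eq_zero.1 (hx0 y hy)).resolve_right (fun h => hn (mem_zs.2 ⟨hy, h⟩))
    have hsub : zs X f ⊆ X := fun y hy => (mem_zs.1 hy).1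
    refine Finset.mem_convexHull'.2 ⟨w, fun y hy => hw y (hsub hy), ?_, ?_⟩
    · rw [← h1]
      exact sum_subset hsub hz
    · apply sum_subset hsub
      intro y hy hn
      rw [hz y hy hn, zero_smul]
  · have hsub : zs X f ⊆ X := fun y hy => (mem_zs.1 hy).1
    apply convexHull_min
    · intro x hx
      exact ⟨subset_convexHull ℝ _ (hsub hx), (mem_zs.1 (mem_coe.1 hx)).2⟩
    · rintro x ⟨hx, hx0⟩ y ⟨hy, hy0⟩ a b ha hb hab
      refine ⟨convex_convexHull ℝ _ hx hy ha hb hab, ?_⟩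
      rw [h] at *
      simp only [map_add, map_smul, smul_eq_mul]
      have : c = a * c + b * c := by rw [← add_mul, hab, one_mul]
      linear_combination a * hx0 + b * hy0 + this

theorem verts_hull {X T : Finset (Fin d → ℝ)}
    (hX : verts (convexHull ℝ (X : Set (Fin d → ℝ))) = X) (hT : T ⊆ X) :
    verts (convexHull ℝ (T : Set (Fin d → ℝ))) = T := by
  apply Set.Subset.antisymm extremePoints_convexHull_subset
  intro x hx
  apply inter_extremePoints_subset_extremePoints_of_subset
    (convexHull_mono (𝕜 := ℝ) (coe_subset.2 hT))
  refine ⟨subset_convexHull ℝ _ hx, ?_⟩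
  change x ∈ verts _
  rw [hX]; exact hT hx

theorem hull_inj {X T T' : Finset (Fin d → ℝ)}
    (hX : verts (convexHull ℝ (X : Set (Fin d → ℝ))) = X) (hT : T ⊆ X) (hT' : T' ⊆ X)
    (h : convexHull ℝ (T : Set (Fin d → ℝ)) = convexHull ℝ (T' : Set (Fin d → ℝ))) : T = T' := by
  have h1 := verts_hull hX hT
  rw [h, verts_hull hX hT'] at h1
  exact (coe_injective h1).symm

theorem exists_X {P : Set (Fin d → ℝ)} (hP : IsPolytope P) :
    ∃ X : Finset (Fin d → ℝ), P = convexHull ℝ (X : Set (Fin d → ℝ)) ∧ verts P = X := by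
  obtain ⟨V, rfl⟩ := hP
  have hfin : (verts (convexHull ℝ (V : Set (Fin d → ℝ)))).Finite :=
    V.finite_toSet.subset extremePoints_convexHull_subset
  refine ⟨hfin.toFinset, ?_, by simp⟩
  have h := closure_convexHull_extremePoints
    (V.finite_toSet.isCompact_convexHull (𝕜 := ℝ)) (convex_convexHull ℝ (V : Set (Fin d → ℝ)))
  rw [IsClosed.closure_eq] at h
  · rw [Set.Finite.coe_toFinset]; exact h.symm
  · exact (hfin.isCompact_convexHull (𝕜 := ℝ)).isClosed

theorem dual_eq_dotp (φ : Module.Dual ℝ (Fin d → ℝ)) :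
    ∃ b : Fin d → ℝ, ∀ x, φ x = dotp b x := by
  refine ⟨fun i => φ (fun j => if i = j then 1 else 0), fun x => ?_⟩
  rw [LinearMap.pi_apply_eq_sum_univ φ x, dotp]
  exact sum_congr rfl fun i _ => by rw [smul_eq_mul, mul_comm]

/-- dot product as a functional -/
def dotL (b : Fin d → ℝ) : Module.Dual ℝ (Fin d → ℝ) where
  toFun x := dotp b x
  map_add' x y := by simp [dotp, mul_add, sum_add_distrib]
  map_smul' r x := by
    simp only [dotp, Pi.smul_apply, smul_eq_mul, RingHom.id_apply, mul_sum]
    exact sum_congr rfl fun i _ => by ring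

theorem isFace_of {X : Finset (Fin d → ℝ)} {f : (Fin d → ℝ) → ℝ} (hf : f ∈ Aff d) (hN : NN X f)
    (h0 : ∃ x ∈ X, f x ≠ 0) (hz : (zs X f).Nonempty) :
    IsFaceOf (convexHull ℝ (X : Set (Fin d → ℝ))) (convexHull ℝ (zs X f : Set (Fin d → ℝ))) := by
  obtain ⟨h1, h2⟩ := cut_eq hf hN
  obtain ⟨φ, c, h⟩ := hf
  obtain ⟨b, hb⟩ := dual_eq_dotp (-φ)
  have hb' : ∀ x, f x = c - dotp b x := fun x => by rw [h, ← hb]; simp; ring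
  refine Or.inr (Or.inr ⟨b, c, ?_, ?_, ?_⟩)
  · rintro rfl
    obtain ⟨x, hx, hx0⟩ := h0
    obtain ⟨y, hy⟩ := hz
    have h3 := (mem_zs.1 hy).2
    rw [hb'] at h3 hx0
    simp [dotp] at h3 hx0
    exact hx0 h3
  · intro x hx
    have := h1 x hx
    rw [hb'] at this; linarith
  · rw [← h2]
    ext x
    simp only [Set.mem_ofPred_eq, hb']
    refine and_congr_right fun _ => ?_
    constructor <;> intro h <;> linarith

theorem face_eq {X : Finset (Fin d → ℝ)} {F : Set (Fin d → ℝ)}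
    (hF : IsFaceOf (convexHull ℝ (X : Set (Fin d → ℝ))) F) (hne : F.Nonempty)
    (hP : F ≠ convexHull ℝ (X : Set (Fin d → ℝ))) :
    ∃ f ∈ Aff d, NN X f ∧ (∃ x ∈ X, f x ≠ 0) ∧ F = convexHull ℝ (zs X f : Set (Fin d → ℝ)) := by
  rcases hF with rfl | rfl | ⟨b, c, hb, hle, rfl⟩
  · simp at hne
  · exact absurd rfl hP
  · set f : (Fin d → ℝ) → ℝ := fun x => (-dotL b) x + c with hfd
    have hfx : ∀ x, f x = c - dotp b x := fun x => by
      change -(dotp b x) + c = _; ring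
    have hf : f ∈ Aff d := ⟨-dotL b, c, fun x => rfl⟩
    have hN : NN X f := fun x hx => by
      rw [hfx]; linarith [hle x (subset_convexHull ℝ _ hx)]
    have hEq : {x ∈ convexHull ℝ (X : Set (Fin d → ℝ)) | dotp b x = c} =
        convexHull ℝ (zs X f : Set (Fin d → ℝ)) := by
      rw [← (cut_eq hf hN).2]
      ext x
      simp only [Set.mem_ofPred_eq, hfx]
      refine and_congr_right fun _ => ?_
      constructor <;> intro h <;> linarith
    refine ⟨f, hf, hN, ?_, hEq⟩
    by_contra hh
    push Not at hh
    apply hP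
    rw [hEq]
    congr 2
    ext x
    rw [mem_zs]
    exact ⟨fun h => h.1, fun h => ⟨h, hh x h⟩⟩

theorem vert_exposed {X : Finset (Fin d → ℝ)}
    (hX : verts (convexHull ℝ (X : Set (Fin d → ℝ))) = X) {x : Fin d → ℝ} (hx : x ∈ X) :
    ∃ f ∈ Aff d, NN X f ∧ zs X f = {x} := by
  have h1 : x ∈ verts (convexHull ℝ (X : Set (Fin d → ℝ))) := by rw [hX]; exact hx
  rw [verts, (convex_convexHull ℝ _).mem_extremePoints_iff_mem_sdiff_convexHull_sdiff] at h1
  have h2 : x ∉ convexHull ℝ ((X : Set (Fin d → ℝ)) \ {x}) := fun h => h1.2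
    (convexHull_mono (Set.sdiff_subset_sdiff_left (subset_convexHull ℝ _)) h)
  have hc : IsClosed (convexHull ℝ ((X : Set (Fin d → ℝ)) \ {x})) :=
    ((X.finite_toSet.subset Set.sdiff_subset).isCompact_convexHull (𝕜 := ℝ)).isClosed
  obtain ⟨φ, u, h3, h4⟩ := geometric_hahn_banach_point_closed (convex_convexHull ℝ _) hc h2
  have hp : ∀ y ∈ X, y ≠ x → 0 < φ y + -φ x := fun y hy hn => by
    have := h4 y (subset_convexHull ℝ _ ⟨hy, hn⟩)
    linarith
  refine ⟨fun y => φ y + -φ x, ⟨φ.toLinearMap, -φ x, fun y => rfl⟩, ?_, ?_⟩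
  · intro y hy
    by_cases hn : y = x
    · simp [hn]
    · exact (hp y hy hn).le
  · ext y
    rw [mem_zs, mem_singleton]
    constructor
    · rintro ⟨h5, h6⟩
      by_contra hn
      exact (hp y h5 hn).ne' h6
    · rintro rfl
      exact ⟨hx, by ring⟩

theorem one_iff {V : Type*} [AddCommGroup V] [Module ℝ V] (D : Submodule ℝ V) {φ : V} (hφ : φ ∈ D)
    (h0 : φ ≠ 0) : Module.finrank ℝ D = 1 ↔ ∀ ψ ∈ D, ∃ r : ℝ, r • φ = ψ := by
  rw [finrank_eq_one_iff_of_nonzero' (⟨φ, hφ⟩ : D) (fun h => h0 (congrArg Subtype.val h))]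
  constructor
  · intro h ψ hψ
    obtain ⟨r, hr⟩ := h ⟨ψ, hψ⟩
    exact ⟨r, congrArg Subtype.val hr⟩
  · rintro h ⟨ψ, hψ⟩
    obtain ⟨r, hr⟩ := h ψ hψ
    exact ⟨r, Subtype.ext hr⟩

theorem fct_of_dim {X σ : Finset (Fin d → ℝ)} {f : (Fin d → ℝ) → ℝ} (hf : f ∈ Aff d)
    (hN : NN X f) (h0 : ∃ x ∈ X, f x ≠ 0) (hz : zs X f = σ) (hne : σ.Nonempty)
    (hdim : polyDim (convexHull ℝ (σ : Set (Fin d → ℝ))) + 1 = d) : Fct (Aff d) X σ := by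
  refine ⟨f, hf, hN, h0, hz, ?_⟩
  obtain ⟨φ, c, h⟩ := hf
  obtain ⟨y, hy⟩ := hne
  have hfσ : ∀ x ∈ σ, f x = 0 := fun x hx => by rw [← hz] at hx; exact (mem_zs.1 hx).2
  have hann : ∀ (ψ : Module.Dual ℝ (Fin d → ℝ)) (e : ℝ), (∀ x ∈ σ, ψ x + e = 0) →
      ψ ∈ (vectorSpan ℝ (σ : Set (Fin d → ℝ))).dualAnnihilator := by
    intro ψ e he
    rw [mem_ann]
    intro a ha b hb
    linarith [he a ha, he b hb]
  have hone : Module.finrank ℝ (vectorSpan ℝ (σ : Set (Fin d → ℝ))).dualAnnihilator = 1 := by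
    have := ann_card (σ : Set (Fin d → ℝ)); omega
  have hφ := hann φ c (fun x hx => by rw [← h, hfσ x hx])
  have hφ0 : φ ≠ 0 := by
    intro this
    obtain ⟨x, hx, hx0⟩ := h0
    have h1 := hfσ y hy
    rw [h, this] at h1 hx0
    exact hx0 h1
  rintro g ⟨ψ, e, hg⟩ hg0
  have hψ := hann ψ e (fun x hx => by rw [← hg, hg0 x hx])
  obtain ⟨r, hr'⟩ := (one_iff _ hφ hφ0).1 hone ψ hψ
  refine ⟨r, fun x _ => ?_⟩
  have h1 := hfσ y hy
  have h2 := hg0 y hy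
  rw [h] at h1
  rw [hg] at h2
  rw [hg, h, ← hr']
  rw [← hr'] at h2
  simp only [LinearMap.smul_apply, smul_eq_mul] at *
  linear_combination h2 - r * h1

theorem dim_of_fct {X σ : Finset (Fin d → ℝ)} (hd : 2 ≤ d)
    (hX : polyDim (convexHull ℝ (X : Set (Fin d → ℝ))) = d) (h : Fct (Aff d) X σ) :
    σ.Nonempty ∧ polyDim (convexHull ℝ (σ : Set (Fin d → ℝ))) + 1 = d := by
  obtain ⟨f, ⟨φ, c, hf⟩, hN, ⟨z, hzX, hz0⟩, hz, huniq⟩ := h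
  have hfσ : ∀ x ∈ σ, f x = 0 := fun x hx => by rw [← hz] at hx; exact (mem_zs.1 hx).2
  -- any functional vanishing on σ (up to constant) is a multiple of φ
  have key : ∀ (ψ : Module.Dual ℝ (Fin d → ℝ)) (e : ℝ), (∀ x ∈ σ, ψ x + e = 0) →
      ∃ r : ℝ, r • φ = ψ := by
    intro ψ e he
    obtain ⟨r, hr⟩ := huniq (fun x => ψ x + e) ⟨ψ, e, fun _ => rfl⟩ he
    refine ⟨r, ?_⟩
    have : ψ - r • φ = 0 := full_zero hX (fun x hx y hy => by
      have h1 := hr x hx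
      have h2 := hr y hy
      simp only [hf] at h1 h2
      simp only [LinearMap.sub_apply, LinearMap.smul_apply, smul_eq_mul]
      linarith)
    exact (sub_eq_zero.1 this).symm
  have hne : σ.Nonempty := by
    by_contra hh
    rw [not_nonempty_iff_eq_empty] at hh
    subst hh
    have h1 : Module.finrank ℝ (Module.Dual ℝ (Fin d → ℝ)) ≤ 1 :=
      finrank_le_one φ (fun ψ => key ψ 0 (by simp))
    rw [Subspace.dual_finrank_eq] at h1
    simp at h1
    omega
  refine ⟨hne, ?_⟩
  obtain ⟨y, hy⟩ := hne
  have hφ : φ ∈ (vectorSpan ℝ (σ : Set (Fin d → ℝ))).dualAnnihilator := by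
    rw [mem_ann]
    intro a ha b hb
    have h1 := hfσ a ha
    have h2 := hfσ b hb
    rw [hf] at h1 h2
    linarith
  have hone : Module.finrank ℝ (vectorSpan ℝ (σ : Set (Fin d → ℝ))).dualAnnihilator = 1 := by
    refine (one_iff _ hφ ?_).2 ?_
    · intro this
      have h1 := hfσ y hy
      rw [hf, this] at h1 hz0
      exact hz0 h1
    · intro ψ hψ
      rw [mem_ann] at hψ
      exact key ψ (-ψ y) (fun x hx => by rw [hψ x hx y hy]; ring)
  have := ann_card (σ : Set (Fin d → ℝ)); omega

theorem pre_of_indep {σ : Finset (Fin d → ℝ)}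
    (h : AffineIndependent ℝ (fun x : (σ : Set (Fin d → ℝ)) => (x : Fin d → ℝ))) :
    Pre (Aff d) σ := by
  intro c
  rcases σ.eq_empty_or_nonempty with rfl | ⟨y, hy⟩
  · exact ⟨0, Submodule.zero_mem _, by simp⟩
  have hli := (affineIndependent_iff_linearIndependent_vsub ℝ _
    (⟨y, hy⟩ : (σ : Set (Fin d → ℝ)))).1 h
  set b := Module.Basis.span hli with hb
  obtain ⟨φ, hφ⟩ := LinearMap.exists_extend (b.constr ℝ (fun x => c x.1.1 - c y))
  have hv : ∀ i : {x : (σ : Set (Fin d → ℝ)) // x ≠ ⟨y, hy⟩}, φ (i.1.1 - y) = c i.1.1 - c y := by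
    intro i
    have h1 : ((b i : Submodule.span ℝ _) : Fin d → ℝ) = i.1.1 - y := by
      rw [hb, Module.Basis.span_apply]; rfl
    rw [← h1]
    have h2 := LinearMap.congr_fun hφ (b i)
    rw [Module.Basis.constr_basis] at h2
    exact h2
  refine ⟨fun x => φ x + (c y - φ y), ⟨φ, _, fun _ => rfl⟩, fun x hx => ?_⟩
  by_cases hxy : x = y
  · rw [hxy]; ring
  · have := hv ⟨⟨x, hx⟩, fun hh => hxy (congrArg Subtype.val hh)⟩
    simp only [map_sub] at this
    simp only
    linarith

theorem indep_of_dim {σ : Finset (Fin d → ℝ)} (hc : σ.card = d)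
    (hdim : polyDim (convexHull ℝ (σ : Set (Fin d → ℝ))) + 1 = d) :
    AffineIndependent ℝ (fun x : (σ : Set (Fin d → ℝ)) => (x : Fin d → ℝ)) := by
  rw [polyDim_convexHull] at hdim
  refine (affineIndependent_iff_finrank_vectorSpan_eq ℝ _
    (n := Module.finrank ℝ (vectorSpan ℝ (σ : Set (Fin d → ℝ)))) ?_).2 ?_
  · simp; omega
  · rw [Subtype.range_coe]

theorem dim_of_indep {τ : Finset (Fin d → ℝ)} {i : ℕ} (hc : τ.card = i + 1)
    (h : AffineIndependent ℝ (fun x : (τ : Set (Fin d → ℝ)) => (x : Fin d → ℝ))) :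
    polyDim (convexHull ℝ (τ : Set (Fin d → ℝ))) = i := by
  rw [polyDim_convexHull]
  have := h.finrank_vectorSpan (n := i) (by simp; omega)
  rwa [Subtype.range_coe] at this
end geo3

section geo4
variable {k : ℕ}

theorem faces_finite {d : ℕ} (X : Finset (Fin d → ℝ)) (i : ℕ) :
    {F : Set (Fin d → ℝ) | IsFaceOf (convexHull ℝ (X : Set (Fin d → ℝ))) F ∧ F.Nonempty ∧
      polyDim F = i}.Finite := by
  refine (X.powerset.finite_toSet.image
    (fun T : Finset (Fin d → ℝ) => convexHull ℝ (T : Set (Fin d → ℝ)))).subset ?_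
  rintro F ⟨h1, h2, -⟩
  by_cases hF : F = convexHull ℝ (X : Set (Fin d → ℝ))
  · exact ⟨X, by simp, hF.symm⟩
  · obtain ⟨f, _, _, _, h3⟩ := face_eq h1 h2 hF
    exact ⟨zs X f, by
      rw [mem_coe, mem_powerset]; exact fun x hx => (mem_zs.1 hx).1, h3.symm⟩

theorem fVec_ge {d : ℕ} {X : Finset (Fin d → ℝ)}
    (hX : verts (convexHull ℝ (X : Set (Fin d → ℝ))) = X) (i : ℕ)
    (C : Finset (Finset (Fin d → ℝ)))
    (hC : ∀ T ∈ C, T ⊆ X ∧ T.Nonempty ∧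
      IsFaceOf (convexHull ℝ (X : Set (Fin d → ℝ))) (convexHull ℝ (T : Set (Fin d → ℝ))) ∧
      polyDim (convexHull ℝ (T : Set (Fin d → ℝ))) = i) :
    C.card ≤ fVec (convexHull ℝ (X : Set (Fin d → ℝ))) i := by
  rw [fVec, ← Set.ncard_coe_finset C]
  refine Set.ncard_le_ncard_of_injOn
    (fun T : Finset (Fin d → ℝ) => convexHull ℝ (T : Set (Fin d → ℝ))) ?_ ?_ (faces_finite X i)
  · intro T hT
    obtain ⟨_, h2, h3, h4⟩ := hC T hT
    exact ⟨h3, (convexHull_nonempty_iff).2 (coe_nonempty.2 h2), h4⟩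
  · intro T hT T' hT' h
    exact hull_inj hX (hC T hT).1 (hC T' hT').1 h

theorem main_cfg {n s : ℕ} {P : Set (Fin (k + 3) → ℝ)} (hP : MemASP (k + 3) n s P) :
    ∃ X W : Finset (Fin (k + 3) → ℝ), Cfg (k + 2) (Aff (k + 3)) X W ∧ X.card = n ∧
      W.card = k + 3 + s ∧ (fcts (Aff (k + 3)) X W).card + 1 ≤ fVec P (k + 2) ∧
      ∀ i ≤ k + 1, (fc (fcts (Aff (k + 3)) X W) (i + 1)).card ≤ fVec P i := by
  obtain ⟨hn, F, ⟨hpoly, hdim, ⟨hFf, hFne, hFd⟩, hsimp⟩, hFc⟩ := hP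
  obtain ⟨X, rfl, hX⟩ := exists_X hpoly
  rw [hX, Set.ncard_coe_finset] at hn
  have hFd' : polyDim F = k + 2 := hFd
  obtain ⟨p, hpA, hpN, hp0, rfl⟩ := face_eq hFf hFne (by
    rintro rfl; omega)
  set W := zs X p with hW
  have hWX : W ⊆ X := fun x hx => (mem_zs.1 hx).1
  rw [verts_hull hX hWX, Set.ncard_coe_finset] at hFc
  have hWne : W.Nonempty := card_pos.1 (by omega)
  have hfW : Fct (Aff (k + 3)) X W := fct_of_dim hpA hpN hp0 rfl hWne (by omega)
  have hfacet : ∀ σ, Fct (Aff (k + 3)) X σ → σ.Nonempty ∧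
      IsFaceOf (convexHull ℝ (X : Set (Fin (k + 3) → ℝ))) (convexHull ℝ (σ : Set (Fin (k + 3) → ℝ)))
      ∧ polyDim (convexHull ℝ (σ : Set (Fin (k + 3) → ℝ))) = k + 2 := by
    intro σ hσ
    obtain ⟨h1, h2⟩ := dim_of_fct (by omega) hdim hσ
    obtain ⟨f, hf, hN, h0, hz, _⟩ := hσ
    refine ⟨h1, ?_, by omega⟩
    rw [← hz] at h1 ⊢
    exact isFace_of hf hN h0 h1
  have hcard : ∀ σ, Fct (Aff (k + 3)) X σ → σ ≠ W → σ.card = k + 3 := by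
    intro σ hσ hne
    obtain ⟨h1, h2, h3⟩ := hfacet σ hσ
    have := hsimp _ ⟨h2, (convexHull_nonempty_iff).2 (coe_nonempty.2 h1), h3⟩
      (fun h => hne (hull_inj hX hσ.sub hWX h))
    rwa [verts_hull hX hσ.sub, Set.ncard_coe_finset] at this
  have hind : ∀ σ, Fct (Aff (k + 3)) X σ → σ ≠ W →
      AffineIndependent ℝ (fun x : (σ : Set (Fin (k + 3) → ℝ)) => (x : Fin (k + 3) → ℝ)) :=
    fun σ hσ hne => indep_of_dim (hcard σ hσ hne) (by rw [(hfacet σ hσ).2.2])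
  have H : Cfg (k + 2) (Aff (k + 3)) X W :=
    { two := by omega
      fW := hfW
      card := hcard
      pre := fun σ hσ hne => pre_of_indep (hind σ hσ hne)
      vert := fun x hx => vert_exposed hX hx
      cW := by omega }
  refine ⟨X, W, H, hn, hFc, ?_, ?_⟩
  · have hWn : W ∉ fcts (Aff (k + 3)) X W := fun h => (mem_fcts.1 h).2 rfl
    rw [← card_insert_of_notMem hWn]
    refine fVec_ge hX _ _ fun T hT => ?_
    have hT' : Fct (Aff (k + 3)) X T := by
      rcases mem_insert.1 hT with rfl | h
      · exact hfW
      · exact (mem_fcts.1 h).1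
    exact ⟨hT'.sub, hfacet T hT'⟩
  · intro i hi
    refine fVec_ge hX _ _ fun τ hτ => ?_
    obtain ⟨hτ, hτc⟩ := mem_fc.1 hτ
    have hτne : τ.Nonempty := card_pos.1 (by omega)
    refine ⟨Cfg.isFc_sub hτ, hτne, ?_, ?_⟩
    · obtain ⟨f, hf, hN, hz⟩ := H.F1 hτ
      obtain ⟨y, hy, hyn⟩ := exists_not_mem_of_card_lt (s := τ) (t := W) (by omega)
      rw [← hz] at hτne ⊢
      refine isFace_of hf hN ⟨y, hWX hy, fun h => hyn ?_⟩ hτne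
      rw [← hz]; exact mem_zs.2 ⟨hWX hy, h⟩
    · obtain ⟨σ, h1, h2⟩ := hτ
      obtain ⟨h3, h4⟩ := mem_fcts.1 h1
      exact dim_of_indep hτc ((hind σ h3 h4).mono (coe_subset.2 h2))
end geo4

/-- **Lower Bound Theorem for almost simplicial polytopes.**
For `d ≥ 3`, `s ≥ 0`, `n ≥ d+s+1` and `P ∈ 𝒫(d,n,s)`:
`f_i(P) ≥ C(d,i)·n − C(d+1,i+1)·i` for `1 ≤ i ≤ d−3`,
`f_{d−2}(P) ≥ C(d,d−2)·n − C(d+1,d−1)·(d−2) − s`, and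
`f_{d−1}(P) ≥ (d−1)·n − (d+1)(d−2) − s`. -/
theorem lbt_asp (d n s : ℕ) (hd : 3 ≤ d) (hn : d + s + 1 ≤ n)
    (P : Set (Fin d → ℝ)) (hP : MemASP d n s P) :
    (∀ i : ℕ, 1 ≤ i → i ≤ d - 3 →
      (d.choose i : ℤ) * n - ((d + 1).choose (i + 1) : ℤ) * i ≤ (fVec P i : ℤ)) ∧
    ((d.choose (d - 2) : ℤ) * n - ((d + 1).choose (d - 1) : ℤ) * ((d : ℤ) - 2) - s
        ≤ (fVec P (d - 2) : ℤ)) ∧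
    (((d : ℤ) - 1) * n - ((d : ℤ) + 1) * ((d : ℤ) - 2) - s ≤ (fVec P (d - 1) : ℤ)) := by
  obtain ⟨k, rfl⟩ : ∃ k, d = k + 3 := ⟨d - 3, by omega⟩
  obtain ⟨X, W, H, hXn, hWc, htop, hlow⟩ := main_cfg hP
  have hR := H.rel
  have hvs : (vs (fcts (Aff (k + 3)) X W)).card = n := by rw [H.vs_eq, hXn]
  have hin : (vs (fcts (Aff (k + 3)) X W) ∩ W).card = k + 3 + s := by rw [H.inter, hWc]
  refine ⟨?_, ?_, ?_⟩
  · intro i hi1 hi2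
    obtain ⟨j, rfl⟩ : ∃ j, i = j + 1 := ⟨i - 1, by omega⟩
    have h1 := Rel.fi j (k + 2) _ W hR (by omega)
    have h2 := hlow (j + 1) (by omega)
    rw [hvs] at h1
    have h3 : (k + 3).choose (j + 1) * n ≤ fVec P (j + 1) + (k + 3 + 1).choose (j + 1 + 1) * (j + 1) :=
      h1.trans (Nat.add_le_add_right h2 _)
    have h4 : ((k + 3).choose (j + 1) : ℤ) * n ≤
      fVec P (j + 1) + ((k + 3 + 1).choose (j + 1 + 1) : ℤ) * ((j + 1 : ℕ) : ℤ) := by exact_mod_cast h3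
    linarith
  · have h1 := hR.ridge_bound
    have h2 := hlow (k + 1) (by omega)
    rw [hvs, hin] at h1
    have e1 : k + 3 - 2 = k + 1 := by omega
    have e2 : k + 3 - 1 = k + 2 := by omega
    rw [e1, e2]
    have c1 : (k + 3).choose (k + 1) = (k + 3).choose 2 :=
      Nat.choose_symm_of_eq_add (by omega)
    have c2 : (k + 3 + 1).choose (k + 2) = (k + 3 + 1).choose 2 :=
      Nat.choose_symm_of_eq_add (by omega)
    have c3 : (k + 3).choose 2 * 2 = (k + 3) * (k + 2) := by
      rw [Nat.choose_two_right]; exact Nat.div_mul_cancel (Nat.even_mul_pred_self (k + 3)).two_dvd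
    have c4 : (k + 3 + 1).choose 2 * 2 = (k + 3 + 1) * (k + 3) := by
      rw [Nat.choose_two_right]; exact Nat.div_mul_cancel (Nat.even_mul_pred_self (k + 3 + 1)).two_dvd
    rw [c1, c2]
    have h1' := h1.trans (Nat.add_le_add_right (Nat.add_le_add_right (Nat.mul_le_mul_left 2 h2) _) _)
    zify at h1' c3 c4
    push_cast
    nlinarith
  · have h1 := Rel.top k _ W hR
    have h2 : _ ≤ fVec P (k + 3 - 1) := htop
    rw [hvs, hin] at h1
    zify at h1 h2
    push_cast
    nlinarith

end

end ASP
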